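/- arXiv:1903.11635 — 2 statements merged into one kernel-verified Lean document; each statement's English description precedes it below -/
import Mathlib

section
/- Let n ≥ 2, let w₁, …, w_n be real numbers, let i ∈ {1,…,n}, let δ ∈ (0,1), let μ > 0, and let α be a real number with α ≥ (1 + 2δ/(1−δ))·μ. Suppose (1−δ)(n−1) ≤ Σ_{1≤j≤n, j≠i} w_j² ≤ (1+δ)(n−1) and Σ_{1≤j≤n, j≠i} |w_j|³ ≤ (1+δ)·μ·(n−1). Then Pr_{x uniform on {−1,1}^n}[ |Σ_{1≤j≤n, j≠i} w_j x_j| ≤ α ] ≥ 2·(α − (1 + 2δ/(1−δ))·μ)/√(2π(1+δ)(n−1)) − α³/(3√(2π)·((1−δ)(n−1))^{3/2}) − 6.8212·((1+δ)μ)^{4/3}/((1−δ)²·(n−1)^{2/3}). -/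
open Finset Real MeasureTheory ProbabilityTheory
open scoped Classical

/-- sign: maps z to 1 if z > 0 and to −1 if z ≤ 0. -/
noncomputable def sgn (z : ℝ) : ℝ := if 0 < z then 1 else -1

/-- interpret a Bool as ±1. -/
def pm (b : Bool) : ℝ := if b then 1 else -1

/-- probability of an event under the uniform distribution on {−1,1}^n. -/
noncomputable def unifPr (n : ℕ) (E : (Fin n → Bool) → Prop) : ℝ :=
  ((Finset.univ : Finset (Fin n → Bool)).filter E).card / 2 ^ n

/-- expectation under the uniform distribution on {−1,1}^n. -/
noncomputable def unifExp (n : ℕ) (g : (Fin n → Bool) → ℝ) : ℝ :=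
  (∑ x : Fin n → Bool, g x) / 2 ^ n

/-- flip the i-th coordinate. -/
def flipAt {n : ℕ} (i : Fin n) (x : Fin n → Bool) : Fin n → Bool :=
  Function.update x i (!(x i))

/-- influence of coordinate i. -/
noncomputable def infl {n : ℕ} (f : (Fin n → Bool) → ℝ) (i : Fin n) : ℝ :=
  unifPr n (fun x => f x ≠ f (flipAt i x))

/-- total influence. -/
noncomputable def totalInfl {n : ℕ} (f : (Fin n → Bool) → ℝ) : ℝ :=
  ∑ i, infl f i

/-- Fourier coefficient f̂(S). -/
noncomputable def fCoeff {n : ℕ} (f : (Fin n → Bool) → ℝ) (S : Finset (Fin n)) : ℝ :=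
  unifExp n (fun x => f x * ∏ i ∈ S, pm (x i))

/-- Fourier entropy with log base 2 (0 · log(1/0) is 0 by convention, which holds
definitionally since `Real.log 0 = 0` in Mathlib). -/
noncomputable def fourierEntropy {n : ℕ} (f : (Fin n → Bool) → ℝ) : ℝ :=
  ∑ S : Finset (Fin n), (fCoeff f S) ^ 2 * Real.logb 2 (1 / (fCoeff f S) ^ 2)

/-- The linear threshold function with weights w₀, w₁, …, w_n. -/
noncomputable def ltf (n : ℕ) (w : Fin (n + 1) → ℝ) : (Fin n → Bool) → ℝ :=
  fun x => sgn (w 0 + ∑ i : Fin n, w i.succ * pm (x i))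


noncomputable def cK (u : ℝ) : ℝ := (1 - u) * (cos (π * u) / sin (π * u)) + 1 / π

noncomputable def bF (y : ℝ) : ℝ :=
  ∫ u in (0:ℝ)..1, ((1 - u) * cos (2 * π * u * y) + cK u * sin (2 * π * u * y))

lemma x_mul_cos_le_sin {x : ℝ} (h0 : 0 ≤ x) (h1 : x ≤ π) : x * cos x ≤ sin x := by
  have hs := sin_nonneg_of_nonneg_of_le_pi h0 h1
  rcases le_or_gt (cos x) 0 with hc | hc
  · nlinarith
  · have hx : x < π / 2 := by
      by_contra hcon
      push Not at hcon
      have := cos_nonpos_of_pi_div_two_le_of_le hcon (by linarith [pi_pos])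
      linarith
    have := Real.le_tan h0 hx
    rw [tan_eq_sin_div_cos, le_div_iff₀ hc] at this
    exact this

lemma cK_le {u : ℝ} (h0 : 0 < u) (h1 : u ≤ 1) : cK u ≤ 1 / (π * u) := by
  have hp := pi_pos
  rcases h1.eq_or_lt with rfl | h1
  · simp [cK]
  have hs : 0 < sin (π * u) := sin_pos_of_pos_of_lt_pi (by positivity) (by nlinarith)
  have h := x_mul_cos_le_sin (x := π * u) (by positivity) (by nlinarith)
  have h2 : cos (π * u) / sin (π * u) ≤ 1 / (π * u) := by
    rw [div_le_div_iff₀ hs (by positivity)]; linarith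
  have h3 : (1 - u) * (cos (π * u) / sin (π * u)) ≤ (1 - u) * (1 / (π * u)) :=
    mul_le_mul_of_nonneg_left h2 (by linarith)
  have h4 : (1 - u) * (1 / (π * u)) + 1 / π = 1 / (π * u) := by field_simp; ring
  unfold cK; linarith

lemma cK_symm {u : ℝ} : cK u = 1 / π - (1 - u) * (cos (π * (1 - u)) / sin (π * (1 - u))) := by
  have e : π * (1 - u) = π - π * u := by ring
  rw [e, cos_pi_sub, sin_pi_sub]; unfold cK; ring

lemma cK_nonneg {u : ℝ} (h0 : 0 < u) (h1 : u ≤ 1) : 0 ≤ cK u := by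
  have hp := pi_pos
  rcases h1.eq_or_lt with rfl | h1
  · simp [cK, hp.le]
  rw [cK_symm]
  set v := 1 - u with hv
  have hv0 : 0 < v := by linarith
  have hs : 0 < sin (π * v) := sin_pos_of_pos_of_lt_pi (by positivity) (by nlinarith)
  have h := x_mul_cos_le_sin (x := π * v) (by positivity) (by nlinarith)
  have h2 : cos (π * v) / sin (π * v) ≤ 1 / (π * v) := by
    rw [div_le_div_iff₀ hs (by positivity)]; linarith
  have h3 : v * (cos (π * v) / sin (π * v)) ≤ v * (1 / (π * v)) :=
    mul_le_mul_of_nonneg_left h2 (by linarith)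
  have h4 : v * (1 / (π * v)) = 1 / π := by field_simp
  linarith

lemma cK_le_one_sub {u : ℝ} (h0 : 1 / 2 ≤ u) (h1 : u < 1) : cK u ≤ 1 - u := by
  have hp := pi_pos
  rw [cK_symm]
  set v := 1 - u with hv
  have hv0 : 0 < v := by linarith
  have hx1 : π * v ≤ π / 2 := by nlinarith
  set x := π * v with hx
  have hx0 : 0 < x := by positivity
  have hs : 0 < sin x := sin_pos_of_pos_of_lt_pi hx0 (by nlinarith)
  have hc : 0 ≤ cos x := cos_nonneg_of_neg_pi_div_two_le_of_le (by linarith) hx1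
  have key : (1 - x) * sin x ≤ x * cos x := by
    rcases le_or_gt 1 x with h | h
    · nlinarith [mul_nonneg hx0.le hc]
    · have a1 := one_sub_sq_div_two_le_cos (x := x)
      have a2 := sin_le hx0.le
      nlinarith [mul_le_mul_of_nonneg_left a2 (by linarith : (0:ℝ) ≤ 1 - x), mul_le_mul_of_nonneg_left a1 hx0.le, mul_pos hx0 hx0]
  have h2 : (1 - x) / x ≤ cos x / sin x := by
    rw [div_le_div_iff₀ hx0 hs]; linarith
  have h3 := mul_le_mul_of_nonneg_left h2 hv0.le
  have h4 : v * ((1 - x) / x) = 1 / π - v := by rw [hx]; field_simp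
  linarith

lemma cK_near {u : ℝ} (h0 : 0 < u) (h1 : u ≤ 1) : 1 / (π * u) - cK u ≤ π / 2 * u := by
  have hp := pi_pos
  have hp3 := pi_gt_three
  rcases le_or_gt (1/2) u with h | h
  · have a := cK_nonneg h0 h1
    have : 1 / (π * u) ≤ π / 2 * u := by
      rw [div_le_iff₀ (by positivity)]
      have : 9 ≤ π ^ 2 := by nlinarith
      have : 1/4 ≤ u ^ 2 := by nlinarith
      nlinarith [mul_nonneg (sub_nonneg.2 ‹9 ≤ π^2›) (sub_nonneg.2 this)]
    linarith
  · have hx1 : π * u ≤ π / 2 := by nlinarith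
    have e : 1 / (π * u) - cK u = (1 - u) * (1 / (π * u) - cos (π * u) / sin (π * u)) := by
      unfold cK; field_simp; ring
    rw [e]
    set x := π * u with hx
    have hx0 : 0 < x := by positivity
    have hs : 0 < sin x := sin_pos_of_pos_of_lt_pi hx0 (by nlinarith)
    have hc : 0 ≤ cos x := cos_nonneg_of_neg_pi_div_two_le_of_le (by linarith) hx1
    have key : sin x * (1 - x ^ 2 / 2) ≤ x * cos x := by
      have a1 := one_sub_sq_div_two_le_cos (x := x)
      have a2 := sin_le hx0.le
      rcases le_or_gt 0 (1 - x^2/2) with h | h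
      · exact mul_le_mul a2 a1 h hx0.le
      · nlinarith [mul_nonneg hx0.le hc]
    have h2 : 1 / x - cos x / sin x ≤ x / 2 := by
      rw [div_sub_div _ _ hx0.ne' hs.ne', div_le_iff₀ (by positivity)]
      nlinarith
    have h3 : 0 ≤ 1 / x - cos x / sin x := by
      rw [div_sub_div _ _ hx0.ne' hs.ne']
      have := x_mul_cos_le_sin (x := x) hx0.le (by linarith)
      apply div_nonneg _ (by positivity)
      linarith
    have : π / 2 * u = x / 2 := by rw [hx]; ring
    rw [this]
    nlinarith

lemma cK_meas : Measurable cK := by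
  unfold cK; fun_prop

lemma ii_of_bound {f : ℝ → ℝ} (hf : Measurable f) (C : ℝ) (h : ∀ u, 0 < u → u ≤ 1 → |f u| ≤ C) :
    IntervalIntegrable f volume 0 1 := by
  rw [intervalIntegrable_iff_integrableOn_Ioc_of_le zero_le_one]
  apply IntegrableOn.of_bound (by simp) hf.aestronglyMeasurable C
  filter_upwards [self_mem_ae_restrict measurableSet_Ioc] with u hu
  simpa using h u hu.1 hu.2

lemma cK_sin_bound {u : ℝ} (h0 : 0 < u) (h1 : u ≤ 1) (y : ℝ) :
    |cK u * sin (2 * π * u * y)| ≤ 2 * |y| := by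
  have hp := pi_pos
  rw [abs_mul, abs_of_nonneg (cK_nonneg h0 h1)]
  have h := abs_sin_le_abs (x := 2 * π * u * y)
  rw [abs_mul, abs_of_pos (by positivity : 0 < 2 * π * u)] at h
  calc _ ≤ 1 / (π * u) * (2 * π * u * |y|) :=
        mul_le_mul (cK_le h0 h1) h (abs_nonneg _) (by positivity)
    _ = _ := by field_simp

lemma cK_cos_bound {u : ℝ} (h0 : 0 < u) (h1 : u ≤ 1) (y : ℝ) :
    |cK u * (cos (2 * π * u * y) - 1)| ≤ 4 * |y| := by
  have hp := pi_pos
  have e : cos (2 * π * u * y) - 1 = - (2 * sin (2 * π * u * (y/2)) ^ 2) := by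
    have : 2 * π * u * y = 2 * (2 * π * u * (y/2)) := by ring
    rw [this, cos_two_mul]; nlinarith [sin_sq_add_cos_sq (2 * π * u * (y/2))]
  have h := cK_sin_bound h0 h1 (y/2)
  have h2 := abs_sin_le_one (2 * π * u * (y/2))
  have : cK u * (cos (2 * π * u * y) - 1) = -2 * ((cK u * sin (2 * π * u * (y/2))) * sin (2 * π * u * (y/2))) := by
    rw [e]; ring
  rw [this, abs_mul, abs_mul _ (sin _)]
  have : |(-2:ℝ)| = 2 := by norm_num
  rw [this]
  have h3 : |y/2| = |y|/2 := by rw [abs_div]; norm_num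
  rw [h3] at h
  nlinarith [abs_nonneg (cK u * sin (2 * π * u * (y/2))), abs_nonneg (sin (2 * π * u * (y/2))), abs_nonneg y]

lemma bF_ii (y : ℝ) : IntervalIntegrable
    (fun u => (1 - u) * cos (2 * π * u * y) + cK u * sin (2 * π * u * y)) volume 0 1 := by
  have := cK_meas
  apply ii_of_bound (by fun_prop) (1 + 2 * |y|)
  intro u h0 h1
  refine (abs_add_le _ _).trans (add_le_add ?_ (cK_sin_bound h0 h1 y))
  rw [abs_mul]
  have := abs_cos_le_one (2 * π * u * y)
  have h2 : |1 - u| ≤ 1 := by rw [abs_le]; constructor <;> linarith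
  nlinarith [abs_nonneg (cos (2 * π * u * y)), abs_nonneg (1-u)]

lemma RL (f : ℝ → ℝ) (hf : Measurable f) (C : ℝ) (h : ∀ u, 0 < u → u ≤ 1 → |f u| ≤ C) :
    Filter.Tendsto (fun n : ℕ => ∫ u in (0:ℝ)..1, f u * cos (2 * π * u * n)) Filter.atTop (nhds 0) ∧
    Filter.Tendsto (fun n : ℕ => ∫ u in (0:ℝ)..1, f u * sin (2 * π * u * n)) Filter.atTop (nhds 0) := by
  have ii := ii_of_bound hf C h
  rw [intervalIntegrable_iff_integrableOn_Ioc_of_le zero_le_one] at ii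
  have T := Real.tendsto_integral_exp_smul_cocompact (fun u => (((Set.Ioc (0:ℝ) 1).indicator f u : ℝ) : ℂ))
  have hn : Filter.Tendsto (fun n : ℕ => (n : ℝ)) Filter.atTop (Filter.cocompact ℝ) := by
    refine (tendsto_natCast_atTop_atTop (R := ℝ)).mono_right atTop_le_cocompact
  have T2 := T.comp hn
  have key : ∀ n : ℕ, (∫ v : ℝ, Real.fourierChar (-(v * (n:ℝ))) • (((Set.Ioc (0:ℝ) 1).indicator f v : ℝ) : ℂ))
      = ((∫ u in (0:ℝ)..1, f u * cos (2 * π * u * n) : ℝ) : ℂ)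
        - ((∫ u in (0:ℝ)..1, f u * sin (2 * π * u * n) : ℝ) : ℂ) * Complex.I := by
    intro n
    rw [intervalIntegral.integral_of_le zero_le_one, intervalIntegral.integral_of_le zero_le_one]
    have i1 : IntegrableOn (fun u => f u * cos (2 * π * u * n)) (Set.Ioc 0 1) :=
      ii.mul_bdd (c := 1) (by fun_prop) (by filter_upwards with u; simpa using abs_cos_le_one _)
    have i2 : IntegrableOn (fun u => f u * sin (2 * π * u * n)) (Set.Ioc 0 1) :=
      ii.mul_bdd (c := 1) (by fun_prop) (by filter_upwards with u; simpa using abs_sin_le_one _)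
    rw [← integral_complex_ofReal, ← integral_complex_ofReal, ← integral_mul_const, ← integral_sub i1.ofReal (i2.ofReal.mul_const _),
      ← integral_indicator measurableSet_Ioc]
    congr 1; ext v
    by_cases hv : v ∈ Set.Ioc (0:ℝ) 1
    · simp only [Set.indicator_of_mem hv]
      rw [Circle.smul_def, Real.fourierChar_apply, smul_eq_mul]
      have : ((2 * π * (-(v * (n:ℝ))) : ℝ) : ℂ) * Complex.I = ((-(2 * π * v * n) : ℝ) : ℂ) * Complex.I := by
        push_cast; ring
      rw [this, Complex.exp_mul_I, ← Complex.ofReal_cos, ← Complex.ofReal_sin, cos_neg, sin_neg]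
      push_cast; ring
    · simp [Set.indicator_of_notMem hv]
  have T3 : Filter.Tendsto (fun n : ℕ => ((∫ u in (0:ℝ)..1, f u * cos (2 * π * u * n) : ℝ) : ℂ)
        - ((∫ u in (0:ℝ)..1, f u * sin (2 * π * u * n) : ℝ) : ℂ) * Complex.I) Filter.atTop (nhds 0) :=
    T2.congr key
  constructor
  · have := (Complex.continuous_re.tendsto _).comp T3
    simpa [Function.comp_def] using this
  · have := ((Complex.continuous_im.tendsto _).comp T3).neg
    simpa [Function.comp_def] using this


noncomputable def sF (y : ℝ) : ℝ := ∫ u in (0:ℝ)..1, 2 * ((1 - u) * cos (2 * π * u * y))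

lemma int_cos (k : ℝ) (hk : k ≠ 0) : ∫ u in (0:ℝ)..1, (1 - u) * cos (k * u) = (1 - cos k) / k ^ 2 := by
  have h : ∀ u ∈ Set.uIcc (0:ℝ) 1, HasDerivAt (fun u => (1 - u) * sin (k * u) / k - cos (k * u) / k ^ 2)
      ((1 - u) * cos (k * u)) u := by
    intro u _
    have h1 : HasDerivAt (fun u : ℝ => k * u) k u := by simpa using (hasDerivAt_id u).const_mul k
    have h2 : HasDerivAt (fun u : ℝ => 1 - u) (-1) u := by simpa using (hasDerivAt_id u).const_sub 1
    refine (((h2.mul h1.sin).div_const k).sub (h1.cos.div_const (k^2))).congr_deriv ?_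
    field_simp; ring
  rw [intervalIntegral.integral_eq_sub_of_hasDerivAt h (by apply Continuous.intervalIntegrable; fun_prop)]
  simp; field_simp; ring

lemma int_sin (k : ℝ) (hk : k ≠ 0) : ∫ u in (0:ℝ)..1, sin (k * u) = (1 - cos k) / k := by
  have h : ∀ u ∈ Set.uIcc (0:ℝ) 1, HasDerivAt (fun u => - cos (k * u) / k)
      (sin (k * u)) u := by
    intro u _
    have h1 : HasDerivAt (fun u : ℝ => k * u) k u := by simpa using (hasDerivAt_id u).const_mul k
    refine (h1.cos.neg.div_const k).congr_deriv ?_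
    field_simp
  rw [intervalIntegral.integral_eq_sub_of_hasDerivAt h (by apply Continuous.intervalIntegrable; fun_prop)]
  simp; field_simp; ring

lemma one_sub_cos (y : ℝ) : 1 - cos (2 * π * y) = 2 * sin (π * y) ^ 2 := by
  have : 2 * π * y = 2 * (π * y) := by ring
  rw [this, cos_two_mul]; nlinarith [sin_sq_add_cos_sq (π * y)]

lemma sF_eq {y : ℝ} (hy : y ≠ 0) : sF y = sin (π * y) ^ 2 / π ^ 2 / y ^ 2 := by
  have hp := pi_pos.ne'
  unfold sF
  rw [intervalIntegral.integral_const_mul]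
  have := int_cos (2 * π * y) (by positivity)
  rw [one_sub_cos] at this
  have e : ∀ u : ℝ, 2 * π * u * y = 2 * π * y * u := fun u => by ring
  simp only [e, this]
  field_simp

lemma int_sin' {y : ℝ} (hy : y ≠ 0) : ∫ u in (0:ℝ)..1, 1 / π * sin (2 * π * u * y) = sin (π * y) ^ 2 / π ^ 2 / y := by
  have hp := pi_pos.ne'
  rw [intervalIntegral.integral_const_mul]
  have := int_sin (2 * π * y) (by positivity)
  rw [one_sub_cos] at this
  have e : ∀ u : ℝ, 2 * π * u * y = 2 * π * y * u := fun u => by ring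
  simp only [e, this]
  field_simp

lemma bF_rec0 (y : ℝ) : bF y - bF (y + 1) = - sF (y + 1)
    - (∫ u in (0:ℝ)..1, 1 / π * sin (2 * π * u * (y + 1))) + ∫ u in (0:ℝ)..1, 1 / π * sin (2 * π * u * y) := by
  unfold bF sF
  rw [← intervalIntegral.integral_sub (bF_ii y) (bF_ii (y+1)), ← intervalIntegral.integral_neg,
    ← intervalIntegral.integral_sub, ← intervalIntegral.integral_add]
  · apply intervalIntegral.integral_congr_ae
    have : ∀ᵐ u : ℝ, u ≠ 1 := by simp [ae_iff]
    filter_upwards [this] with u hu1 hu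
    rw [Set.uIoc_of_le zero_le_one] at hu
    have hp := pi_pos
    have hu1 : u < 1 := lt_of_le_of_ne hu.2 hu1
    have hs : 0 < sin (π * u) := sin_pos_of_pos_of_lt_pi (mul_pos hp hu.1) (by nlinarith)
    have e : 2 * π * u * (y + 1) = 2 * π * u * y + 2 * (π * u) := by ring
    rw [e, cos_add, sin_add, cos_two_mul, sin_two_mul]
    generalize 2 * π * u * y = A
    unfold cK
    have hq := sin_sq_add_cos_sq (π * u)
    generalize sin (π * u) = s at *
    generalize cos (π * u) = c at *
    have hc : c ^ 2 = 1 - s ^ 2 := by linarith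
    field_simp
    ring_nf
    have h3 : c ^ 3 = c * (1 - s^2) := by rw [← hc]; ring
    simp only [hc, h3]
    ring
  all_goals apply Continuous.intervalIntegrable; fun_prop

lemma bF_rec {y : ℝ} (hy : 0 < y) : bF y - bF (y + 1) =
    sin (π * y) ^ 2 / π ^ 2 * (1 / (y * (y + 1)) - 1 / (y + 1) ^ 2) := by
  rw [bF_rec0, sF_eq (by positivity), int_sin' (by positivity), int_sin' (by positivity)]
  have : sin (π * (y + 1)) ^ 2 = sin (π * y) ^ 2 := by
    rw [mul_add, mul_one, sin_add_pi]; ring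
  rw [this]
  have hp := pi_pos.ne'
  field_simp; ring

lemma bF_neg (y : ℝ) : bF y + bF (-y) = sF y := by
  unfold bF sF
  rw [← intervalIntegral.integral_add (bF_ii y) (bF_ii (-y))]
  congr 1; ext u
  have : 2 * π * u * -y = -(2 * π * u * y) := by ring
  rw [this, cos_neg, sin_neg]; ring

lemma bF_zero : bF 0 = 1 / 2 := by
  unfold bF
  simp only [mul_zero, cos_zero, sin_zero, mul_one, add_zero]
  rw [intervalIntegral.integral_sub (by simp) (by simp)]
  simp
  norm_num

lemma bF_nat (n : ℕ) : bF n = 1 / 2 := by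
  induction n with
  | zero => simpa using bF_zero
  | succ n ih =>
    have h := bF_rec0 n
    have hs : ∀ m : ℕ, sin (π * m) = 0 := fun m => by rw [mul_comm]; exact sin_nat_mul_pi m
    have h1 : ∫ u in (0:ℝ)..1, 1 / π * sin (2 * π * u * (n:ℝ)) = 0 := by
      rcases Nat.eq_zero_or_pos n with rfl | hn
      · simp
      · rw [int_sin' (by positivity), hs]; simp
    have h2 : ∫ u in (0:ℝ)..1, 1 / π * sin (2 * π * u * ((n:ℝ)+1)) = 0 := by
      rw [int_sin' (by positivity)]
      have := hs (n+1)
      push_cast at this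
      rw [this]; simp
    have h3 : sF ((n:ℝ)+1) = 0 := by
      rw [sF_eq (by positivity)]
      have := hs (n+1)
      push_cast at this
      rw [this]; simp
    push_cast
    linarith

lemma bF_lim (y : ℝ) : Filter.Tendsto (fun n : ℕ => bF (y + n)) Filter.atTop (nhds (1/2)) := by
  have hm := cK_meas
  have b1 : ∀ u, 0 < u → u ≤ 1 → |(1 - u) * (cos (2*π*u*y) - 1) + cK u * sin (2*π*u*y)| ≤ 2 + 2 * |y| := by
    intro u h0 h1
    refine (abs_add_le _ _).trans (add_le_add ?_ (cK_sin_bound h0 h1 y))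
    have := cos_le_one (2*π*u*y)
    have := neg_one_le_cos (2*π*u*y)
    rw [abs_le]; constructor <;> nlinarith
  have b2 : ∀ u, 0 < u → u ≤ 1 → |-((1 - u) * sin (2*π*u*y)) + cK u * (cos (2*π*u*y) - 1)| ≤ 1 + 4 * |y| := by
    intro u h0 h1
    refine (abs_add_le _ _).trans (add_le_add ?_ (cK_cos_bound h0 h1 y))
    have := sin_le_one (2*π*u*y)
    have := neg_one_le_sin (2*π*u*y)
    rw [abs_le]; constructor <;> nlinarith
  have R1 := (RL _ (by fun_prop) _ b1).1
  have R2 := (RL _ (by fun_prop) _ b2).2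
  have R := (R1.add R2).add_const (1/2)
  simp only [add_zero, zero_add] at R
  refine R.congr ?_
  intro n
  rw [← bF_nat n]
  unfold bF
  have i1 : IntervalIntegrable (fun u => ((1 - u) * (cos (2*π*u*y) - 1) + cK u * sin (2*π*u*y)) * cos (2 * π * u * n)) volume 0 1 :=
    (ii_of_bound (by fun_prop) _ b1).mul_continuousOn (by fun_prop)
  have i2 : IntervalIntegrable (fun u => (-((1 - u) * sin (2*π*u*y)) + cK u * (cos (2*π*u*y) - 1)) * sin (2 * π * u * n)) volume 0 1 :=
    (ii_of_bound (by fun_prop) _ b2).mul_continuousOn (by fun_prop)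
  rw [← intervalIntegral.integral_add i1 i2, ← intervalIntegral.integral_add (i1.add i2) (bF_ii n)]
  congr 1; ext u
  have : 2 * π * u * (y + n) = 2 * π * u * y + 2 * π * u * n := by ring
  rw [this, cos_add, sin_add]; ring

lemma bF_ge_half {y : ℝ} (hy : 0 ≤ y) : 1 / 2 ≤ bF y := by
  rcases hy.eq_or_lt with rfl | hy
  · rw [bF_zero]
  have step : ∀ z : ℝ, 0 < z → bF (z + 1) ≤ bF z := by
    intro z hz
    have := bF_rec hz
    have h2 : 1 / (z + 1) ^ 2 ≤ 1 / (z * (z + 1)) := by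
      apply one_div_le_one_div_of_le (by positivity); nlinarith
    have : 0 ≤ sin (π * z) ^ 2 / π ^ 2 * (1 / (z * (z + 1)) - 1 / (z + 1) ^ 2) :=
      mul_nonneg (by positivity) (by linarith)
    linarith
  refine le_of_tendsto (bF_lim y) (Filter.Eventually.of_forall ?_)
  intro n
  induction n with
  | zero => simp
  | succ n ih =>
    have := step (y + n) (by positivity)
    push_cast; rw [← add_assoc]; linarith

lemma sF_lim (y : ℝ) (hy : 0 < y) : Filter.Tendsto (fun n : ℕ => sF (y + n)) Filter.atTop (nhds 0) := by
  have h1 : ∀ n : ℕ, sF (y + n) = sin (π * y) ^ 2 / π ^ 2 / (y + n) ^ 2 := by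
    intro n
    rw [sF_eq (by positivity)]
    have : sin (π * (y + n)) ^ 2 = sin (π * y) ^ 2 := by
      rw [mul_add, mul_comm π (n:ℝ), sin_add_nat_mul_pi, mul_pow, ← pow_mul, mul_comm n 2, pow_mul]; simp
    rw [this]
  simp only [h1]
  apply Filter.Tendsto.div_atTop tendsto_const_nhds
  apply (Filter.tendsto_pow_atTop (n := 2) (by norm_num)).comp
  exact Filter.tendsto_atTop_add_const_left _ _ tendsto_natCast_atTop_atTop

lemma bF_ge_neg_half (y : ℝ) : -(1 / 2) ≤ bF y := by
  rcases le_or_gt 0 y with hy | hy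
  · linarith [bF_ge_half hy]
  obtain ⟨z, rfl⟩ : ∃ z, y = -z := ⟨-y, by simp⟩
  have hz : 0 < z := by linarith
  have hn := bF_neg z
  suffices bF z - sF z ≤ 1 / 2 by linarith
  have step : ∀ z : ℝ, 0 < z → bF z - sF z ≤ bF (z + 1) - sF (z + 1) := by
    intro z hz
    have h := bF_rec hz
    rw [sF_eq hz.ne', sF_eq (by positivity : z + 1 ≠ 0)]
    have : sin (π * (z + 1)) ^ 2 = sin (π * z) ^ 2 := by
      rw [mul_add, mul_one, sin_add_pi]; ring
    rw [this]
    have h2 : 1 / (z * (z + 1)) ≤ 1 / z ^ 2 := by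
      apply one_div_le_one_div_of_le (by positivity); nlinarith
    have h3 : 0 ≤ sin (π * z) ^ 2 / π ^ 2 * (1 / z ^ 2 - 1 / (z * (z + 1))) :=
      mul_nonneg (by positivity) (by linarith)
    have e1 : sin (π * z) ^ 2 / π ^ 2 / z ^ 2 = sin (π * z) ^ 2 / π ^ 2 * (1 / z ^ 2) := by ring
    have e2 : sin (π * z) ^ 2 / π ^ 2 / (z+1) ^ 2 = sin (π * z) ^ 2 / π ^ 2 * (1 / (z+1) ^ 2) := by ring
    rw [e1, e2]
    nlinarith
  have L := (bF_lim z).sub (sF_lim z hz)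
  rw [sub_zero] at L
  refine ge_of_tendsto L (Filter.Eventually.of_forall ?_)
  intro n
  induction n with
  | zero => simp
  | succ n ih =>
    have := step (z + n) (by positivity)
    push_cast; rw [← add_assoc]; linarith


lemma avg_cos (n : ℕ) (v : Fin n → ℝ) (θ : ℝ) :
    ∑ x : Fin n → Bool, cos (θ * ∑ j, v j * pm (x j)) = 2 ^ n * ∏ j, cos (θ * v j) := by
  have h : (∏ j, ∑ b : Bool, Complex.exp (((θ * (v j * pm b) : ℝ) : ℂ) * Complex.I)) =
      ∑ x : Fin n → Bool, ∏ j, Complex.exp (((θ * (v j * pm (x j)) : ℝ) : ℂ) * Complex.I) := by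
    rw [Finset.prod_univ_sum, Fintype.piFinset_univ]
  have h1 : ∀ j, ∑ b : Bool, Complex.exp (((θ * (v j * pm b) : ℝ) : ℂ) * Complex.I)
      = ((2 * cos (θ * v j) : ℝ) : ℂ) := by
    intro j
    simp only [Fintype.sum_bool, pm, Complex.exp_mul_I, ← Complex.ofReal_cos, ← Complex.ofReal_sin]
    simp
    ring
  have h2 : ∀ x : Fin n → Bool, ∏ j, Complex.exp (((θ * (v j * pm (x j)) : ℝ) : ℂ) * Complex.I)
      = Complex.exp (((θ * ∑ j, v j * pm (x j) : ℝ) : ℂ) * Complex.I) := by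
    intro x
    rw [← Complex.exp_sum, ← Finset.sum_mul, ← Complex.ofReal_sum, Finset.mul_sum]
  simp only [h1, h2] at h
  have h3 := congrArg Complex.re h
  rw [← Complex.ofReal_prod, Complex.ofReal_re, Complex.re_sum] at h3
  simp only [Complex.exp_ofReal_mul_I_re] at h3
  rw [← h3, Finset.prod_mul_distrib]
  simp

lemma ker_ii (l a S : ℝ) : IntervalIntegrable
    (fun u => 2 * (cos (l * u * S) * (cK u * sin (l * u * a) - (1 - u) * cos (l * u * a)))) volume 0 1 := by
  have hm := cK_meas
  have hp := pi_pos
  apply ii_of_bound (by fun_prop) (2 * (2 * |l * a / (2 * π)| + 1))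
  intro u h0 h1
  have h := cK_sin_bound h0 h1 (l * a / (2 * π))
  have e : 2 * π * u * (l * a / (2 * π)) = l * u * a := by field_simp
  rw [e] at h
  rw [abs_mul, abs_mul]
  have h2 := abs_cos_le_one (l * u * S)
  have h3 : |cK u * sin (l * u * a) - (1 - u) * cos (l * u * a)| ≤ 2 * |l * a / (2 * π)| + 1 := by
    refine (abs_sub _ _).trans (add_le_add h ?_)
    have := cos_le_one (l * u * a)
    have := neg_one_le_cos (l * u * a)
    rw [abs_le]; constructor <;> nlinarith
  rw [abs_of_pos (by norm_num : (0:ℝ) < 2)]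
  nlinarith [abs_nonneg (cos (l * u * S)), abs_nonneg (cK u * sin (l * u * a) - (1 - u) * cos (l * u * a))]

lemma ker_eq (l a S : ℝ) : - bF (l / (2 * π) * (S - a)) - bF (l / (2 * π) * (- S - a)) =
    ∫ u in (0:ℝ)..1, 2 * (cos (l * u * S) * (cK u * sin (l * u * a) - (1 - u) * cos (l * u * a))) := by
  have hp := pi_pos
  unfold bF
  rw [← intervalIntegral.integral_neg, ← intervalIntegral.integral_sub (by exact (bF_ii _).neg) (bF_ii _)]
  congr 1; ext u
  have e1 : 2 * π * u * (l / (2 * π) * (S - a)) = l * u * S - l * u * a := by field_simp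
  have e2 : 2 * π * u * (l / (2 * π) * (- S - a)) = - (l * u * S + l * u * a) := by field_simp; ring
  rw [e1, e2, cos_neg, sin_neg, cos_add, cos_sub, sin_add, sin_sub]
  ring

lemma pr_ge (n : ℕ) (v : Fin n → ℝ) (l a : ℝ) (hl : 0 < l) :
    (∫ u in (0:ℝ)..1, 2 * ((∏ j, cos (l * u * v j)) * (cK u * sin (l * u * a) - (1 - u) * cos (l * u * a))))
      ≤ unifPr n (fun x => |∑ j, v j * pm (x j)| ≤ a) := by
  have hp := pi_pos
  unfold unifPr
  rw [le_div_iff₀ (by positivity), Finset.card_filter, Nat.cast_sum]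
  have key : ∀ x : Fin n → Bool,
      (∫ u in (0:ℝ)..1, 2 * (cos (l * u * ∑ j, v j * pm (x j)) * (cK u * sin (l * u * a) - (1 - u) * cos (l * u * a))))
      ≤ ((if |∑ j, v j * pm (x j)| ≤ a then 1 else 0 : ℕ) : ℝ) := by
    intro x
    rw [← ker_eq]
    set S := ∑ j, v j * pm (x j)
    have hl' : 0 < l / (2 * π) := by positivity
    have g1 := bF_ge_neg_half (l / (2 * π) * (S - a))
    have g2 := bF_ge_neg_half (l / (2 * π) * (-S - a))
    split_ifs with h
    · push_cast; linarith
    · push_cast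
      push Not at h
      rcases lt_abs.1 h with h | h
      · have := bF_ge_half (y := l / (2 * π) * (S - a)) (mul_nonneg hl'.le (by linarith))
        linarith
      · have := bF_ge_half (y := l / (2 * π) * (-S - a)) (mul_nonneg hl'.le (by linarith))
        linarith
  refine le_trans (le_of_eq ?_) (Finset.sum_le_sum (fun x _ => key x))
  rw [← intervalIntegral.integral_finsetSum (fun x _ => ker_ii l a _), ← intervalIntegral.integral_mul_const]
  congr 1; ext u
  rw [← Finset.mul_sum, ← Finset.sum_mul, avg_cos]
  ring

lemma sin_ge_par {x : ℝ} (h0 : 0 ≤ x) (h1 : x ≤ π) : x * (π - x) / π ≤ sin x := by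
  have hp := pi_pos
  have hp4 := pi_lt_d2
  have aux : ∀ x : ℝ, 0 ≤ x → x ≤ π / 2 → x * (π - x) / π ≤ sin x := by
    intro x h0 h1
    refine le_trans ?_ (sin_ge_sub_cube h0)
    rw [div_le_iff₀ hp]
    have : π * x ≤ 6 := by nlinarith
    nlinarith [mul_nonneg (mul_nonneg h0 h0) (sub_nonneg.2 this)]
  rcases le_or_gt x (π/2) with h | h
  · exact aux x h0 h
  · have := aux (π - x) (by linarith) (by linarith)
    rw [sin_pi_sub] at this
    convert this using 2; ring

lemma sin_sq_tangent {x u : ℝ} (h0 : 0 ≤ x) (hu : u ≤ 1) :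
    x ^ 2 * (1 - u) ^ 2 - 2 * (1 - u) * x ^ 2 * (x / π - u) ≤ sin x ^ 2 := by
  have hp := pi_pos
  rcases le_or_gt x π with h | h
  · have h1 := sin_ge_par h0 h
    have h2 : 0 ≤ x * (π - x) / π := div_nonneg (mul_nonneg h0 (by linarith)) hp.le
    have h3 : (x * (π - x) / π) ^ 2 ≤ sin x ^ 2 := pow_le_pow_left₀ h2 h1 2
    have e : x * (π - x) / π = x * (1 - x / π) := by field_simp
    rw [e] at h3
    refine le_trans ?_ h3
    nlinarith [mul_nonneg (sq_nonneg x) (sq_nonneg (x / π - u))]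
  · have : 1 < x / π := by rw [lt_div_iff₀ hp]; linarith
    have e : x ^ 2 * (1 - u) ^ 2 - 2 * (1 - u) * x ^ 2 * (x / π - u) = - (x^2 * ((1 - u) * (2 * (x/π) - u - 1))) := by ring
    rw [e]
    have : 0 ≤ x^2 * ((1 - u) * (2 * (x/π) - u - 1)) := 
      mul_nonneg (sq_nonneg x) (mul_nonneg (by linarith) (by linarith))
    nlinarith [sq_nonneg (sin x)]

lemma phi_bound (n : ℕ) (v : Fin n → ℝ) (b : ℝ) (hb : 0 < b) (h2 : ∑ j, v j ^ 2 = 1)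
    (h3 : ∑ j, |v j| ^ 3 ≤ b) {u : ℝ} (hu0 : 0 ≤ u) (hu : u ≤ 1) :
    |∏ j, cos (π / b * u * v j)| ≤ exp (- (1 / 2 * (π / b * u) ^ 2 * (1 - u) ^ 2)) := by
  have hp := pi_pos
  set t := π / b * u with ht
  have ht0 : 0 ≤ t := by positivity
  have hsum : t ^ 2 * (1 - u) ^ 2 ≤ ∑ j, sin (t * v j) ^ 2 := by
    have h : ∀ j, (t * |v j|) ^ 2 * (1 - u) ^ 2 - 2 * (1 - u) * (t * |v j|) ^ 2 * (t * |v j| / π - u) ≤ sin (t * v j) ^ 2 := by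
      intro j
      have := sin_sq_tangent (x := t * |v j|) (by positivity) hu
      have e : sin (t * |v j|) ^ 2 = sin (t * v j) ^ 2 := by
        rcases abs_cases (v j) with ⟨h, _⟩ | ⟨h, _⟩ <;> rw [h]
        rw [mul_neg, sin_neg]; ring
      rwa [e] at this
    refine le_trans ?_ (Finset.sum_le_sum (fun j _ => h j))
    have e : ∀ j, (t * |v j|) ^ 2 * (1 - u) ^ 2 - 2 * (1 - u) * (t * |v j|) ^ 2 * (t * |v j| / π - u)
      = (t ^ 2 * (1 - u) ^ 2 + 2 * (1 - u) * u * t ^ 2) * v j ^ 2 - 2 * (1 - u) * t ^ 3 / π * |v j| ^ 3 := by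
      intro j
      rw [← sq_abs (v j)]
      field_simp; ring
    simp only [e]
    rw [Finset.sum_sub_distrib, ← Finset.mul_sum, ← Finset.mul_sum, h2]
    have h4 : 2 * (1 - u) * t ^ 3 / π * ∑ j, |v j| ^ 3 ≤ 2 * (1 - u) * t ^ 3 / π * b :=
      mul_le_mul_of_nonneg_left h3 (div_nonneg (mul_nonneg (by linarith) (by positivity)) hp.le)
    have h5 : 2 * (1 - u) * t ^ 3 / π * b = 2 * (1 - u) * u * t ^ 2 := by
      rw [ht]; field_simp
    linarith
  have hsq : (∏ j, cos (t * v j)) ^ 2 ≤ exp (- (t ^ 2 * (1 - u) ^ 2)) := by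
    rw [← Finset.prod_pow]
    calc _ ≤ ∏ j, exp (- sin (t * v j) ^ 2) := by
          apply Finset.prod_le_prod
          · intros; positivity
          · intro j _
            have := add_one_le_exp (- sin (t * v j) ^ 2)
            nlinarith [sin_sq_add_cos_sq (t * v j)]
      _ = exp (- ∑ j, sin (t * v j) ^ 2) := by rw [← Real.exp_sum, Finset.sum_neg_distrib]
      _ ≤ _ := by apply exp_le_exp.2; linarith
  refine abs_le_of_sq_le_sq ?_ (exp_pos _).le
  refine hsq.trans (le_of_eq ?_)
  rw [← Real.exp_nat_mul]
  congr 1; push_cast; ring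

lemma cos_le_exp {x : ℝ} (h0 : 0 ≤ x) (hx : x ^ 2 ≤ 2) : cos x ≤ exp (-(x ^ 2 / 2)) := by
  have h := sin_ge_sub_cube (x := x / 2) (by positivity)
  have hb : 0 ≤ x / 2 - (x / 2) ^ 3 / 6 := by nlinarith
  have h1 : (x / 2 - (x / 2) ^ 3 / 6) ^ 2 ≤ sin (x / 2) ^ 2 := pow_le_pow_left₀ hb h 2
  have h2 : cos x = 1 - 2 * sin (x / 2) ^ 2 := by
    have : x = 2 * (x / 2) := by ring
    conv_lhs => rw [this, cos_two_mul]
    nlinarith [sin_sq_add_cos_sq (x/2)]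
  have h3 := add_one_le_exp (-(x ^ 2 / 4))
  have h4 : (1 - x ^ 2 / 4) ^ 2 ≤ exp (-(x ^ 2 / 4)) ^ 2 := pow_le_pow_left₀ (by linarith) (by linarith) 2
  have h5 : exp (-(x ^ 2 / 4)) ^ 2 = exp (-(x ^ 2 / 2)) := by
    rw [← Real.exp_nat_mul]; congr 1; push_cast; ring
  rw [h5] at h4
  nlinarith [sq_nonneg (x^2), sq_nonneg (x^3)]

lemma phi_close (n : ℕ) (v : Fin n → ℝ) (g : ℝ) (hg : 0 < g) (h2 : ∑ j, v j ^ 2 = 1)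
    (h3 : ∑ j, |v j| ^ 3 ≤ g ^ 3) {t : ℝ} (ht0 : 0 ≤ t) (ht : t ^ 2 * g ^ 2 ≤ 2) :
    |(∏ j, cos (t * v j)) - exp (-(t ^ 2 / 2))| ≤ g ^ 4 / 4 * t ^ 4 * exp (-(t ^ 2 / 2)) := by
  have hv : ∀ j, |v j| ≤ g := by
    intro j
    have : |v j| ^ 3 ≤ g ^ 3 :=
      (Finset.single_le_sum (f := fun j => |v j| ^ 3) (fun i _ => by positivity) (Finset.mem_univ j)).trans h3
    exact le_of_pow_le_pow_left₀ (by norm_num) hg.le this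
  have hx : ∀ j, (t * |v j|) ^ 2 ≤ 2 := by
    intro j
    rw [mul_pow]
    have := pow_le_pow_left₀ (abs_nonneg _) (hv j) 2
    nlinarith [mul_le_mul_of_nonneg_left this (sq_nonneg t)]
  have hcos : ∀ j, cos (t * v j) = cos (t * |v j|) := by
    intro j
    rw [← cos_abs (t * v j), abs_mul, abs_of_nonneg ht0]
  have hE : exp (-(t ^ 2 / 2)) = ∏ j, exp (-((t * |v j|) ^ 2 / 2)) := by
    rw [← Real.exp_sum]
    congr 1
    have : ∀ j, -((t * |v j|) ^ 2 / 2) = - (t ^ 2 / 2) * v j ^ 2 := by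
      intro j; rw [mul_pow, sq_abs]; ring
    simp only [this]
    rw [← Finset.mul_sum, h2]; ring
  have hlow : ∀ j, 1 - (t * |v j|) ^ 2 / 2 ≤ cos (t * |v j|) := fun j => one_sub_sq_div_two_le_cos
  have hup : ∏ j, cos (t * v j) ≤ exp (-(t ^ 2 / 2)) := by
    rw [hE]
    apply Finset.prod_le_prod
    · intro j _; rw [hcos]; linarith [hlow j, hx j]
    · intro j _; rw [hcos]; exact cos_le_exp (by positivity) (hx j)
  have hfac : ∀ j, exp (-((t * |v j|) ^ 2 / 2)) * (1 - (t * |v j|) ^ 4 / 4) ≤ cos (t * v j) := by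
    intro j
    rw [hcos]
    refine le_trans ?_ (hlow j)
    set y := (t * |v j|) ^ 2 / 2 with hy
    have hy1 : y ≤ 1 := by linarith [hx j]
    have hy0 : 0 ≤ y := by positivity
    have e : 1 - (t * |v j|) ^ 4 / 4 = (1 - y) * (1 + y) := by rw [hy]; ring
    rw [e]
    have h := add_one_le_exp y
    have hm : exp (-y) * exp y = 1 := by rw [← Real.exp_add]; simp
    have : exp (-y) * (1 + y) ≤ 1 := by
      rw [← hm]; exact mul_le_mul_of_nonneg_left (by linarith) (exp_pos _).le
    nlinarith
  have h4 : ∑ j, (t * |v j|) ^ 4 / 4 ≤ g ^ 4 / 4 * t ^ 4 := by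
    have : ∀ j, (t * |v j|) ^ 4 / 4 ≤ t ^ 4 / 4 * g * |v j| ^ 3 := by
      intro j
      have := mul_le_mul_of_nonneg_left (hv j) (by positivity : 0 ≤ t ^ 4 / 4 * |v j| ^ 3)
      nlinarith
    refine (Finset.sum_le_sum (fun j _ => this j)).trans ?_
    rw [← Finset.mul_sum]
    have := mul_le_mul_of_nonneg_left h3 (by positivity : 0 ≤ t ^ 4 / 4 * g)
    nlinarith
  have hy : ∀ j, 0 ≤ 1 - (t * |v j|) ^ 4 / 4 := by
    intro j
    have := hx j
    nlinarith [sq_nonneg (t * |v j|)]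
  have hprod : 1 - ∑ j, (t * |v j|) ^ 4 / 4 ≤ ∏ j, (1 - (t * |v j|) ^ 4 / 4) := by
    have : ∀ s : Finset (Fin n), 1 - ∑ j ∈ s, (t * |v j|) ^ 4 / 4 ≤ ∏ j ∈ s, (1 - (t * |v j|) ^ 4 / 4) := by
      intro s
      induction s using Finset.induction_on with
      | empty => simp
      | insert j s hj ih =>
        rw [Finset.sum_insert hj, Finset.prod_insert hj]
        have p := hy j
        have q : 0 ≤ ∑ j ∈ s, (t * |v j|) ^ 4 / 4 := Finset.sum_nonneg (fun j _ => by positivity)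
        have r : 0 ≤ (t * |v j|) ^ 4 / 4 := by positivity
        nlinarith [mul_le_mul_of_nonneg_left ih p]
    exact this _
  have hdown : exp (-(t ^ 2 / 2)) * (1 - g ^ 4 / 4 * t ^ 4) ≤ ∏ j, cos (t * v j) := by
    calc _ ≤ exp (-(t ^ 2 / 2)) * ∏ j, (1 - (t * |v j|) ^ 4 / 4) :=
          mul_le_mul_of_nonneg_left (by linarith) (exp_pos _).le
      _ = ∏ j, (exp (-((t * |v j|) ^ 2 / 2)) * (1 - (t * |v j|) ^ 4 / 4)) := by
          rw [hE, Finset.prod_mul_distrib]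
      _ ≤ _ := by
          apply Finset.prod_le_prod
          · intro j _; exact mul_nonneg (exp_pos _).le (hy j)
          · intro j _; exact hfac j
  rw [abs_le]
  constructor
  · nlinarith
  · have : 0 ≤ g ^ 4 / 4 * t ^ 4 * exp (-(t ^ 2 / 2)) := by positivity
    linarith


lemma cK_le_lin {u : ℝ} (h0 : 1 / 3 ≤ u) (h1 : u < 1) : cK u ≤ 6 / π * (1 - u) := by
  have hp := pi_pos
  have hp4 := pi_lt_d2
  rcases le_or_gt u (1/2) with h | h
  · have a := cK_le (u := u) (by linarith) h1.le
    have b : 1 / (π * u) ≤ 3 / π := by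
      rw [div_le_div_iff₀ (by positivity) hp]; nlinarith
    have c : 3 / π ≤ 6 / π * (1 - u) := by
      have : 6 / π * (1 - u) - 3 / π = 6 / π * (1/2 - u) := by ring
      have : 0 ≤ 6 / π * (1/2 - u) := mul_nonneg (by positivity) (by linarith)
      linarith
    linarith
  · have a := cK_le_one_sub h.le h1
    have : 1 ≤ 6 / π := by rw [le_div_iff₀ hp]; linarith
    nlinarith

set_option maxHeartbeats 1000000 in
lemma pt_err (n : ℕ) (v : Fin n → ℝ) (g : ℝ) (hg : 0 < g) (h2 : ∑ j, v j ^ 2 = 1)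
    (h3 : ∑ j, |v j| ^ 3 ≤ g ^ 3) (l : ℝ) (hl : l = π / g ^ 3) {u : ℝ} (h0 : 0 < u) (h1 : u < 1) :
    |(∏ j, cos (l * u * v j)) - exp (-((l * u) ^ 2 / 2))| * (cK u + (1 - u)) ≤
      (1 / π + 1 / 4) * g ^ 4 / 4 * l ^ 4 * (u ^ 3 * exp (-(l ^ 2 / 2 * u ^ 2)))
      + (1 / π + 1 / 4) * g ^ 4 / 4 * l ^ 4 * (u ^ 3 * exp (-(2 / 9 * l ^ 2 * u ^ 2)))
      + (6 / π + 1) * ((1 - u) * exp (-(l ^ 2 / 18 * (1 - u) ^ 2))) := by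
  have hp := pi_pos
  have hl0 : 0 < l := by rw [hl]; positivity
  have m0 : 0 ≤ cK u + (1 - u) := add_nonneg (cK_nonneg h0 h1.le) (by linarith)
  have m1 : cK u + (1 - u) ≤ (1 / π + 1 / 4) / u := by
    have a := cK_le h0 h1.le
    have b : 1 - u ≤ 1 / 4 / u := by rw [le_div_iff₀ h0]; nlinarith [sq_nonneg (u - 1/2)]
    have : (1 / π + 1 / 4) / u = 1 / (π * u) + 1 / 4 / u := by field_simp
    linarith
  have e1 : exp (-(l ^ 2 / 2 * u ^ 2)) = exp (-((l * u) ^ 2 / 2)) := by congr 1; ring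
  rw [e1]
  have ex1 := exp_pos (-((l * u) ^ 2 / 2))
  have ex2 := exp_pos (-(2 / 9 * l ^ 2 * u ^ 2))
  have ex3 := exp_pos (-(l ^ 2 / 18 * (1 - u) ^ 2))
  have t3 : 0 ≤ (6 / π + 1) * ((1 - u) * exp (-(l ^ 2 / 18 * (1 - u) ^ 2))) :=
    mul_nonneg (by positivity) (mul_nonneg (by linarith) ex3.le)
  have t2 : 0 ≤ (1 / π + 1 / 4) * g ^ 4 / 4 * l ^ 4 * (u ^ 3 * exp (-(2 / 9 * l ^ 2 * u ^ 2))) := by positivity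
  have conv : ∀ F : ℝ, (g ^ 4 / 4 * (l * u) ^ 4 * F) * ((1 / π + 1 / 4) / u) =
      (1 / π + 1 / 4) * g ^ 4 / 4 * l ^ 4 * (u ^ 3 * F) := by
    intro F; field_simp
  rcases le_or_gt ((l * u) ^ 2 * g ^ 2) 2 with ht | ht
  · have h := phi_close n v g hg h2 h3 (t := l * u) (by positivity) ht
    have := mul_le_mul h m1 m0 (by positivity)
    rw [conv] at this
    linarith
  · have hbig : 1 ≤ g ^ 4 / 4 * (l * u) ^ 4 := by
      have : ((l * u) ^ 2 * g ^ 2) ^ 2 = g ^ 4 * (l * u) ^ 4 := by ring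
      nlinarith
    have hphi := phi_bound n v (g^3) (by positivity) h2 h3 h0.le h1.le
    rw [← hl] at hphi
    have hE : exp (-((l * u) ^ 2 / 2)) * (cK u + (1 - u)) ≤
        (1 / π + 1 / 4) * g ^ 4 / 4 * l ^ 4 * (u ^ 3 * exp (-((l * u) ^ 2 / 2))) := by
      rw [← conv]
      apply mul_le_mul _ m1 m0 (by positivity)
      nlinarith
    have hF : |∏ j, cos (l * u * v j)| * (cK u + (1 - u)) ≤
        (1 / π + 1 / 4) * g ^ 4 / 4 * l ^ 4 * (u ^ 3 * exp (-(2 / 9 * l ^ 2 * u ^ 2)))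
      + (6 / π + 1) * ((1 - u) * exp (-(l ^ 2 / 18 * (1 - u) ^ 2))) := by
      rcases le_or_gt u (1/3) with hu | hu
      · have a : |∏ j, cos (l * u * v j)| ≤ exp (-(2 / 9 * l ^ 2 * u ^ 2)) := by
          refine hphi.trans (exp_le_exp.2 ?_)
          have : (4:ℝ)/9 ≤ (1 - u) ^ 2 := by nlinarith
          nlinarith [mul_le_mul_of_nonneg_left this (sq_nonneg (l * u))]
        have b : |∏ j, cos (l * u * v j)| * (cK u + (1 - u)) ≤
            (1 / π + 1 / 4) * g ^ 4 / 4 * l ^ 4 * (u ^ 3 * exp (-(2 / 9 * l ^ 2 * u ^ 2))) := by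
          rw [← conv]
          apply mul_le_mul _ m1 m0 (by positivity)
          nlinarith
        linarith
      · have a : |∏ j, cos (l * u * v j)| ≤ exp (-(l ^ 2 / 18 * (1 - u) ^ 2)) := by
          refine hphi.trans (exp_le_exp.2 ?_)
          have : (1:ℝ)/9 ≤ u ^ 2 := by nlinarith
          nlinarith [mul_le_mul_of_nonneg_left this (mul_nonneg (sq_nonneg l) (sq_nonneg (1 - u)))]
        have b := cK_le_lin hu.le h1
        have c : cK u + (1 - u) ≤ (6 / π + 1) * (1 - u) := by linarith
        have := mul_le_mul a c m0 ex3.le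
        have e : exp (-(l ^ 2 / 18 * (1 - u) ^ 2)) * ((6 / π + 1) * (1 - u)) =
          (6 / π + 1) * ((1 - u) * exp (-(l ^ 2 / 18 * (1 - u) ^ 2))) := by ring
        rw [e] at this
        linarith
    have tri := abs_sub (∏ j, cos (l * u * v j)) (exp (-((l * u) ^ 2 / 2)))
    rw [abs_of_pos ex1] at tri
    have := mul_le_mul_of_nonneg_right tri m0
    linarith

lemma pt_main (n : ℕ) (v : Fin n → ℝ) (g : ℝ) (hg : 0 < g) (h2 : ∑ j, v j ^ 2 = 1)
    (h3 : ∑ j, |v j| ^ 3 ≤ g ^ 3) (l : ℝ) (hl : l = π / g ^ 3) (a : ℝ) (ha : 0 ≤ a)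
    {u : ℝ} (h0 : 0 < u) (h1 : u < 1) :
    2 * (l / π * a - 1) * exp (-(l ^ 2 / 2 * u ^ 2))
      - l ^ 3 / π * a ^ 3 / 3 * (u ^ 2 * exp (-(l ^ 2 / 2 * u ^ 2)))
      - π * (u * exp (-(l ^ 2 / 2 * u ^ 2)))
      - (1 / π + 1 / 4) * g ^ 4 / 2 * l ^ 4 * (u ^ 3 * exp (-(l ^ 2 / 2 * u ^ 2)))
      - (1 / π + 1 / 4) * g ^ 4 / 2 * l ^ 4 * (u ^ 3 * exp (-(2 / 9 * l ^ 2 * u ^ 2)))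
      - 2 * (6 / π + 1) * ((1 - u) * exp (-(l ^ 2 / 18 * (1 - u) ^ 2))) ≤
    2 * ((∏ j, cos (l * u * v j)) * (cK u * sin (l * u * a) - (1 - u) * cos (l * u * a))) := by
  have hp := pi_pos
  have hl0 : 0 < l := by rw [hl]; positivity
  have err := pt_err n v g hg h2 h3 l hl h0 h1
  have e1 : exp (-((l * u) ^ 2 / 2)) = exp (-(l ^ 2 / 2 * u ^ 2)) := by congr 1; ring
  rw [e1] at err
  set E := exp (-(l ^ 2 / 2 * u ^ 2)) with hE
  have hE0 : 0 < E := exp_pos _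
  set P := ∏ j, cos (l * u * v j)
  set s := sin (l * u * a)
  set c := cos (l * u * a)
  have hs1 : |s| ≤ 1 := abs_sin_le_one _
  have hc1 : |c| ≤ 1 := abs_cos_le_one _
  have c0 := cK_nonneg h0 h1.le
  have k1 : |cK u * s - (1 - u) * c| ≤ cK u + (1 - u) := by
    refine (abs_sub _ _).trans ?_
    rw [abs_mul, abs_mul, abs_of_nonneg c0, abs_of_pos (by linarith : 0 < 1 - u)]
    nlinarith
  have d1 : -(|P - E| * (cK u + (1 - u))) ≤ (P - E) * (cK u * s - (1 - u) * c) := by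
    have := neg_abs_le ((P - E) * (cK u * s - (1 - u) * c))
    rw [abs_mul] at this
    have := mul_le_mul_of_nonneg_left k1 (abs_nonneg (P - E))
    linarith
  have k2 : l / π * (a - a ^ 3 * (l * u) ^ 2 / 6) - π / 2 * u - 1 ≤ cK u * s - (1 - u) * c := by
    have n1 := cK_near h0 h1.le
    have n2 := cK_le h0 h1.le
    have q1 : (1 / (π * u) - cK u) * s ≤ π / 2 * u := by
      have := le_of_abs_le hs1
      nlinarith
    have q2 : (1 - u) * c ≤ 1 := by
      have := le_of_abs_le hc1
      nlinarith
    have q3 : l / π * (a - a ^ 3 * (l * u) ^ 2 / 6) ≤ 1 / (π * u) * s := by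
      have := sin_ge_sub_cube (x := l * u * a) (by positivity)
      have := mul_le_mul_of_nonneg_left this (by positivity : 0 ≤ 1 / (π * u))
      refine le_trans (le_of_eq ?_) this
      field_simp
    linarith
  have k3 := mul_le_mul_of_nonneg_left k2 hE0.le
  have k4 : E * (l / π * (a - a ^ 3 * (l * u) ^ 2 / 6) - π / 2 * u - 1) =
    (l / π * a - 1) * E - l ^ 3 / π * a ^ 3 / 6 * (u ^ 2 * E) - π / 2 * (u * E) := by ring
  linarith

lemma int_u (Q : ℝ) (hQ : 0 < Q) : ∫ u in (0:ℝ)..1, u * exp (-(Q * u ^ 2)) ≤ 1 / (2 * Q) := by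
  have h : ∀ u ∈ Set.uIcc (0:ℝ) 1, HasDerivAt (fun u => - exp (-(Q * u ^ 2)) / (2 * Q))
      (u * exp (-(Q * u ^ 2))) u := by
    intro u _
    have h1 : HasDerivAt (fun u : ℝ => -(Q * u ^ 2)) (-(Q * (2 * u))) u := by
      exact ((hasDerivAt_pow 2 u).const_mul Q).neg.congr_deriv (by norm_num)
    refine (h1.exp.neg.div_const (2 * Q)).congr_deriv ?_
    field_simp
  rw [intervalIntegral.integral_eq_sub_of_hasDerivAt h (by apply Continuous.intervalIntegrable; fun_prop)]
  have : 0 ≤ exp (-(Q * 1 ^ 2)) / (2 * Q) := by positivity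
  simp at *
  rw [neg_div, neg_div]
  have e : 1 / (2 * Q) = Q⁻¹ * 2⁻¹ := by field_simp
  linarith

lemma int_u3 (Q : ℝ) (hQ : 0 < Q) : ∫ u in (0:ℝ)..1, u ^ 3 * exp (-(Q * u ^ 2)) ≤ 1 / (2 * Q ^ 2) := by
  have h : ∀ u ∈ Set.uIcc (0:ℝ) 1, HasDerivAt (fun u => - ((u ^ 2 + 1 / Q) * exp (-(Q * u ^ 2))) / (2 * Q))
      (u ^ 3 * exp (-(Q * u ^ 2))) u := by
    intro u _
    have h1 : HasDerivAt (fun u : ℝ => -(Q * u ^ 2)) (-(Q * (2 * u))) u := by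
      exact ((hasDerivAt_pow 2 u).const_mul Q).neg.congr_deriv (by norm_num)
    have h2 : HasDerivAt (fun u : ℝ => u ^ 2 + 1 / Q) (2 * u) u := by
      simpa using (hasDerivAt_pow 2 u).add_const (1 / Q)
    refine ((h2.mul h1.exp).neg.div_const (2 * Q)).congr_deriv ?_
    field_simp; ring
  rw [intervalIntegral.integral_eq_sub_of_hasDerivAt h (by apply Continuous.intervalIntegrable; fun_prop)]
  have h0 : 0 ≤ (1 ^ 2 + 1 / Q) * exp (-(Q * 1 ^ 2)) / (2 * Q) := by positivity
  have e : -(((0:ℝ) ^ 2 + 1 / Q) * exp (-(Q * 0 ^ 2))) / (2 * Q) = - (1 / (2 * Q ^ 2)) := by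
    simp; field_simp
  rw [e, neg_div]; linarith

lemma int_u2 (Q : ℝ) (hQ : 0 < Q) : ∫ u in (0:ℝ)..1, u ^ 2 * exp (-(Q * u ^ 2)) ≤
    1 / (2 * Q) * ∫ u in (0:ℝ)..1, exp (-(Q * u ^ 2)) := by
  have h : ∀ u ∈ Set.uIcc (0:ℝ) 1, HasDerivAt (fun u => - (u * exp (-(Q * u ^ 2))) / (2 * Q))
      (u ^ 2 * exp (-(Q * u ^ 2)) - 1 / (2 * Q) * exp (-(Q * u ^ 2))) u := by
    intro u _
    have h1 : HasDerivAt (fun u : ℝ => -(Q * u ^ 2)) (-(Q * (2 * u))) u := by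
      exact ((hasDerivAt_pow 2 u).const_mul Q).neg.congr_deriv (by norm_num)
    refine (((hasDerivAt_id u).mul h1.exp).neg.div_const (2 * Q)).congr_deriv ?_
    simp; field_simp; ring
  have := intervalIntegral.integral_eq_sub_of_hasDerivAt h (by apply Continuous.intervalIntegrable; fun_prop)
  rw [intervalIntegral.integral_sub (by apply Continuous.intervalIntegrable; fun_prop) (by apply Continuous.intervalIntegrable; fun_prop),
    intervalIntegral.integral_const_mul] at this
  have h0 : 0 ≤ exp (-(Q * 1 ^ 2)) / (2 * Q) := by positivity
  simp only [one_mul, zero_mul, neg_zero, zero_div, sub_zero, neg_div] at this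
  linarith

lemma int_v (Q : ℝ) (hQ : 0 < Q) : ∫ u in (0:ℝ)..1, (1 - u) * exp (-(Q * (1 - u) ^ 2)) ≤ 1 / (2 * Q) := by
  rw [intervalIntegral.integral_comp_sub_left (fun u => u * exp (-(Q * u ^ 2))) 1]
  simpa using int_u Q hQ

lemma int_0 (Q : ℝ) (hQ : 0 < Q) : √(π / Q) / 2 - 1 / (2 * Q ^ 2) ≤ ∫ u in (0:ℝ)..1, exp (-(Q * u ^ 2)) := by
  have g := integral_gaussian_Ioi Q
  have gi : Integrable (fun u : ℝ => exp (-Q * u ^ 2)) := integrable_exp_neg_mul_sq hQ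
  have split := intervalIntegral.integral_interval_add_Ioi (a := (0:ℝ)) (b := 1) (f := fun u : ℝ => exp (-Q * u ^ 2)) gi.integrableOn gi.integrableOn
  have gi1 : Integrable (fun u : ℝ => u * exp (-Q * u ^ 2)) := integrable_mul_exp_neg_mul_sq hQ
  have tail : ∫ u in Set.Ioi (1:ℝ), exp (-Q * u ^ 2) ≤ ∫ u in Set.Ioi (1:ℝ), u * exp (-Q * u ^ 2) := by
    apply setIntegral_mono_on gi.integrableOn gi1.integrableOn measurableSet_Ioi
    intro u hu
    have := exp_pos (-Q * u ^ 2)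
    have : 1 < u := hu
    nlinarith
  have tailv : ∫ u in Set.Ioi (1:ℝ), u * exp (-Q * u ^ 2) = exp (-Q) / (2 * Q) := by
    have h : ∀ u ∈ Set.Ici (1:ℝ), HasDerivAt (fun u => - exp (-Q * u ^ 2) / (2 * Q))
        (u * exp (-Q * u ^ 2)) u := by
      intro u _
      have h1 : HasDerivAt (fun u : ℝ => -Q * u ^ 2) (-Q * (2 * u)) u := by
        simpa using ((hasDerivAt_pow 2 u).const_mul (-Q))
      refine (h1.exp.neg.div_const (2 * Q)).congr_deriv ?_
      field_simp
    have lim : Filter.Tendsto (fun u : ℝ => - exp (-Q * u ^ 2) / (2 * Q)) Filter.atTop (nhds 0) := by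
      have : Filter.Tendsto (fun u : ℝ => -Q * u ^ 2) Filter.atTop Filter.atBot :=
        (Filter.tendsto_pow_atTop (n := 2) (by norm_num)).const_mul_atTop_of_neg (by linarith)
      simpa using ((tendsto_exp_atBot.comp this).neg.div_const (2 * Q))
    rw [integral_Ioi_of_hasDerivAt_of_tendsto' h gi1.integrableOn lim]
    simp; ring
  have hexp : exp (-Q) ≤ 1 / Q := by
    rw [exp_neg, ← one_div]
    apply one_div_le_one_div_of_le hQ
    linarith [add_one_le_exp Q]
  have : exp (-Q) / (2 * Q) ≤ 1 / (2 * Q ^ 2) := by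
    have := div_le_div_of_nonneg_right hexp (by positivity : 0 ≤ 2 * Q)
    refine this.trans (le_of_eq ?_); field_simp
  simp only [neg_mul] at *
  linarith


lemma prod_cos_ii (n : ℕ) (v : Fin n → ℝ) (l a : ℝ) : IntervalIntegrable
    (fun u => 2 * ((∏ j, cos (l * u * v j)) * (cK u * sin (l * u * a) - (1 - u) * cos (l * u * a)))) volume 0 1 := by
  have hm := cK_meas
  have hp := pi_pos
  apply ii_of_bound (by fun_prop) (2 * (2 * |l * a / (2 * π)| + 1))
  intro u h0 h1
  have h := cK_sin_bound h0 h1 (l * a / (2 * π))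
  have e : 2 * π * u * (l * a / (2 * π)) = l * u * a := by field_simp
  rw [e] at h
  have h2 : |(1 - u) * cos (l * u * a)| ≤ 1 := by
    rw [abs_mul]
    have := abs_cos_le_one (l * u * a)
    have h2 : |1 - u| ≤ 1 := by rw [abs_le]; constructor <;> linarith
    exact mul_le_one₀ h2 (abs_nonneg _) this
  have h3 : |∏ j, cos (l * u * v j)| ≤ 1 := by
    rw [Finset.abs_prod]
    exact Finset.prod_le_one (fun _ _ => abs_nonneg _) (fun _ _ => abs_cos_le_one _)
  have h4 := (abs_sub (cK u * sin (l * u * a)) ((1 - u) * cos (l * u * a)))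
  rw [abs_mul, abs_mul, abs_of_pos (by norm_num : (0:ℝ) < 2)]
  have h5 : |∏ j, cos (l * u * v j)| * |cK u * sin (l * u * a) - (1 - u) * cos (l * u * a)| ≤
      1 * (2 * |l * a / (2 * π)| + 1) := mul_le_mul h3 (by linarith) (abs_nonneg _) (by norm_num)
  linarith

lemma J_bound (n : ℕ) (v : Fin n → ℝ) (g : ℝ) (hg : 0 < g) (h2 : ∑ j, v j ^ 2 = 1)
    (h3 : ∑ j, |v j| ^ 3 ≤ g ^ 3) (l : ℝ) (hl : l = π / g ^ 3) (a : ℝ) (ha : 0 ≤ a) :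
    2 * (l / π * a - 1) * (∫ u in (0:ℝ)..1, exp (-(l ^ 2 / 2 * u ^ 2)))
      - l ^ 3 / π * a ^ 3 / 3 * (1 / l ^ 2 * ∫ u in (0:ℝ)..1, exp (-(l ^ 2 / 2 * u ^ 2)))
      - π * (1 / l ^ 2)
      - (1 / π + 1 / 4) * g ^ 4 / 2 * l ^ 4 * (2 / l ^ 4)
      - (1 / π + 1 / 4) * g ^ 4 / 2 * l ^ 4 * (81 / (8 * l ^ 4))
      - 2 * (6 / π + 1) * (9 / l ^ 2) ≤ unifPr n (fun x => |∑ j, v j * pm (x j)| ≤ a) := by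
  have hp := pi_pos
  have hl0 : 0 < l := by rw [hl]; positivity
  refine le_trans ?_ (pr_ge n v l a hl0)
  have mono := intervalIntegral.integral_mono_on_of_le_Ioo (μ := volume) zero_le_one
    (f := fun u => 2 * (l / π * a - 1) * exp (-(l ^ 2 / 2 * u ^ 2))
      - l ^ 3 / π * a ^ 3 / 3 * (u ^ 2 * exp (-(l ^ 2 / 2 * u ^ 2)))
      - π * (u * exp (-(l ^ 2 / 2 * u ^ 2)))
      - (1 / π + 1 / 4) * g ^ 4 / 2 * l ^ 4 * (u ^ 3 * exp (-(l ^ 2 / 2 * u ^ 2)))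
      - (1 / π + 1 / 4) * g ^ 4 / 2 * l ^ 4 * (u ^ 3 * exp (-(2 / 9 * l ^ 2 * u ^ 2)))
      - 2 * (6 / π + 1) * ((1 - u) * exp (-(l ^ 2 / 18 * (1 - u) ^ 2))))
    (by apply Continuous.intervalIntegrable; fun_prop) (prod_cos_ii n v l a)
    (fun u hu => pt_main n v g hg h2 h3 l hl a ha hu.1 hu.2)
  refine le_trans ?_ mono
  have c0 : ∀ Q : ℝ, IntervalIntegrable (fun u : ℝ => exp (-(Q * u ^ 2))) volume 0 1 := by
    intro Q; apply Continuous.intervalIntegrable; fun_prop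
  have c1 : ∀ Q : ℝ, IntervalIntegrable (fun u : ℝ => u * exp (-(Q * u ^ 2))) volume 0 1 := by
    intro Q; apply Continuous.intervalIntegrable; fun_prop
  have c2 : ∀ Q : ℝ, IntervalIntegrable (fun u : ℝ => u ^ 2 * exp (-(Q * u ^ 2))) volume 0 1 := by
    intro Q; apply Continuous.intervalIntegrable; fun_prop
  have c3 : ∀ Q : ℝ, IntervalIntegrable (fun u : ℝ => u ^ 3 * exp (-(Q * u ^ 2))) volume 0 1 := by
    intro Q; apply Continuous.intervalIntegrable; fun_prop
  have c4 : ∀ Q : ℝ, IntervalIntegrable (fun u : ℝ => (1 - u) * exp (-(Q * (1 - u) ^ 2))) volume 0 1 := by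
    intro Q; apply Continuous.intervalIntegrable; fun_prop
  have s0 := (c0 (l ^ 2 / 2)).const_mul (2 * (l / π * a - 1))
  have s1 := (c2 (l ^ 2 / 2)).const_mul (l ^ 3 / π * a ^ 3 / 3)
  have s2 := (c1 (l ^ 2 / 2)).const_mul π
  have s3 := (c3 (l ^ 2 / 2)).const_mul ((1 / π + 1 / 4) * g ^ 4 / 2 * l ^ 4)
  have s4 := (c3 (2 / 9 * l ^ 2)).const_mul ((1 / π + 1 / 4) * g ^ 4 / 2 * l ^ 4)
  have s5 := (c4 (l ^ 2 / 18)).const_mul (2 * (6 / π + 1))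
  rw [intervalIntegral.integral_sub ((((s0.sub s1).sub s2).sub s3).sub s4) s5,
    intervalIntegral.integral_sub (((s0.sub s1).sub s2).sub s3) s4,
    intervalIntegral.integral_sub ((s0.sub s1).sub s2) s3,
    intervalIntegral.integral_sub (s0.sub s1) s2,
    intervalIntegral.integral_sub s0 s1]
  simp only [intervalIntegral.integral_const_mul]
  have i1 := int_u2 (l ^ 2 / 2) (by positivity)
  have i2 := int_u (l ^ 2 / 2) (by positivity)
  have i3 := int_u3 (l ^ 2 / 2) (by positivity)
  have i4 := int_u3 (2 / 9 * l ^ 2) (by positivity)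
  have i5 := int_v (l ^ 2 / 18) (by positivity)
  have e1 : 1 / (2 * (l ^ 2 / 2)) = 1 / l ^ 2 := by field_simp
  have e3 : 1 / (2 * (l ^ 2 / 2) ^ 2) = 2 / l ^ 4 := by field_simp
  have e4 : 1 / (2 * (2 / 9 * l ^ 2) ^ 2) = 81 / (8 * l ^ 4) := by field_simp; norm_num
  have e5 : 1 / (2 * (l ^ 2 / 18)) = 9 / l ^ 2 := by field_simp; norm_num
  rw [e1] at i1 i2
  rw [e3] at i3
  rw [e4] at i4
  rw [e5] at i5
  have := mul_le_mul_of_nonneg_left i1 (by positivity : 0 ≤ l ^ 3 / π * a ^ 3 / 3)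
  have := mul_le_mul_of_nonneg_left i2 (by positivity : 0 ≤ π)
  have := mul_le_mul_of_nonneg_left i3 (by positivity : 0 ≤ (1 / π + 1 / 4) * g ^ 4 / 2 * l ^ 4)
  have := mul_le_mul_of_nonneg_left i4 (by positivity : 0 ≤ (1 / π + 1 / 4) * g ^ 4 / 2 * l ^ 4)
  have := mul_le_mul_of_nonneg_left i5 (by positivity : 0 ≤ 2 * (6 / π + 1))
  linarith

lemma unifPr_nonneg' (n : ℕ) (p : (Fin n → Bool) → Prop) : 0 ≤ unifPr n p := by
  unfold unifPr; positivity

set_option maxHeartbeats 1000000 in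
lemma core (n : ℕ) (v : Fin n → ℝ) (g : ℝ) (hg : 0 < g) (h2 : ∑ j, v j ^ 2 = 1)
    (h3 : ∑ j, |v j| ^ 3 ≤ g ^ 3) (a : ℝ) (ha : 0 ≤ a) :
    (2 * a - 2 * g ^ 3 - a ^ 3 / 3) / √(2 * π) - 6.8212 * g ^ 4 ≤
      unifPr n (fun x => |∑ j, v j * pm (x j)| ≤ a) := by
  have hp := pi_pos
  have hp3 : 3.14 < π := pi_gt_d2
  have hp4 : π < 3.15 := pi_lt_d2
  have hnn := unifPr_nonneg' n (fun x => |∑ j, v j * pm (x j)| ≤ a)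
  have hX1 : a - a ^ 3 / 6 ≤ 1 := by
    have : 0 ≤ (a - 1) ^ 2 * (a + 2) := by positivity
    nlinarith [mul_nonneg ha (sq_nonneg (a - 3/2)), sq_nonneg (a - 3/2)]
  set r := √(2 * π) with hr
  have hr0 : 0 < r := by positivity
  have hr2 : 2 ≤ r := by rw [hr]; apply Real.le_sqrt_of_sq_le; linarith
  rcases le_or_gt (a - a ^ 3 / 6 - g ^ 3) 0 with hX | hX
  · refine le_trans ?_ hnn
    have : (2 * a - 2 * g ^ 3 - a ^ 3 / 3) / r ≤ 0 := div_nonpos_of_nonpos_of_nonneg (by linarith) hr0.le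
    have : 0 < g ^ 4 := by positivity
    linarith
  rcases le_or_gt (1 / 2) (g ^ 2) with hgb | hgb
  · refine le_trans ?_ hnn
    have : (2 * a - 2 * g ^ 3 - a ^ 3 / 3) / r ≤ 1 := by
      rw [div_le_one hr0]
      have : 0 < g ^ 3 := by positivity
      linarith
    have : 1 / 4 ≤ g ^ 4 := by nlinarith
    linarith
  have J := J_bound n v g hg h2 h3 (π / g ^ 3) rfl a ha
  refine le_trans ?_ J
  have i0 := int_0 ((π / g ^ 3) ^ 2 / 2) (by positivity)
  set I := ∫ u in (0:ℝ)..1, exp (-((π / g ^ 3) ^ 2 / 2 * u ^ 2)) with hI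
  have sq : √(π / ((π / g ^ 3) ^ 2 / 2)) / 2 = g ^ 3 / r := by
    have hrr : r ^ 2 = 2 * π := Real.sq_sqrt (by positivity)
    have : π / ((π / g ^ 3) ^ 2 / 2) = (2 * (g ^ 3 / r)) ^ 2 := by
      have : (2 * (g ^ 3 / r)) ^ 2 = 4 * g ^ 6 / r ^ 2 := by field_simp; ring
      rw [this, hrr]; field_simp; norm_num
    rw [this, Real.sqrt_sq (by positivity)]; ring
  have sq2 : 1 / (2 * ((π / g ^ 3) ^ 2 / 2) ^ 2) = 2 * g ^ 12 / π ^ 4 := by field_simp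
  rw [sq, sq2] at i0
  set X := a - a ^ 3 / 6 - g ^ 3 with hXd
  have E1 : 2 * (π / g ^ 3 / π * a - 1) * I - (π / g ^ 3) ^ 3 / π * a ^ 3 / 3 * (1 / (π / g ^ 3) ^ 2 * I)
      = 2 * X / g ^ 3 * I := by
    rw [hXd]; field_simp; ring
  have E2 : π * (1 / (π / g ^ 3) ^ 2) = 1 / π * g ^ 6 := by field_simp
  have E3 : (1 / π + 1 / 4) * g ^ 4 / 2 * (π / g ^ 3) ^ 4 * (2 / (π / g ^ 3) ^ 4) = (1 / π + 1 / 4) * g ^ 4 := by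
    field_simp
  have E4 : (1 / π + 1 / 4) * g ^ 4 / 2 * (π / g ^ 3) ^ 4 * (81 / (8 * (π / g ^ 3) ^ 4))
      = 81 / 16 * ((1 / π + 1 / 4) * g ^ 4) := by
    field_simp; norm_num
  have E5 : 2 * (6 / π + 1) * (9 / (π / g ^ 3) ^ 2) = 18 * (6 * (1 / π) + 1) * (1 / π) ^ 2 * g ^ 6 := by
    field_simp; norm_num
  rw [E1, E2, E3, E4, E5]
  have M := mul_le_mul_of_nonneg_left i0 (by positivity : 0 ≤ 2 * X / g ^ 3)
  have M2 : 2 * X / g ^ 3 * (g ^ 3 / r - 2 * g ^ 12 / π ^ 4) = 2 * X / r - 4 * X * g ^ 9 * (1 / π) ^ 4 := by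
    field_simp
    ring
  have M3 : (2 * a - 2 * g ^ 3 - a ^ 3 / 3) / r = 2 * X / r := by rw [hXd]; ring
  rw [M2] at M
  rw [M3]
  set q := 1 / π with hq
  have hq0 : 0 < q := by positivity
  have hq1 : q ≤ 0.319 := by rw [hq, div_le_iff₀ hp]; linarith
  have hq2 : q ^ 2 ≤ 0.102 := by
    have := pow_le_pow_left₀ hq0.le hq1 2
    norm_num at this ⊢; linarith
  have hq4 : q ^ 4 ≤ 0.0105 := by
    have : q ^ 4 = q ^ 2 * q ^ 2 := by ring
    have := mul_le_mul hq2 hq2 (sq_nonneg q) (by norm_num)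
    linarith
  have g4 : 0 < g ^ 4 := by positivity
  have g6 : g ^ 6 ≤ 1 / 2 * g ^ 4 := by
    have : g ^ 6 = g ^ 2 * g ^ 4 := by ring
    rw [this]; exact mul_le_mul_of_nonneg_right hgb.le g4.le
  have g60 : 0 < g ^ 6 := by positivity
  have hXle : X ≤ 1 := by have : 0 < g ^ 3 := by positivity
                          linarith
  have g1 : g ≤ 1 := by by_contra hc; push Not at hc; have := one_lt_pow₀ hc (two_ne_zero); linarith
  have g9 : g ^ 9 ≤ g ^ 6 := pow_le_pow_of_le_one hg.le g1 (by norm_num)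
  have F1 : X * g ^ 9 * q ^ 4 ≤ g ^ 6 * 0.0105 := by
    apply mul_le_mul _ hq4 (by positivity) (by positivity)
    have : 0 < g ^ 9 := by positivity
    have := mul_le_mul_of_nonneg_right hXle this.le
    linarith
  have F2 : q * g ^ 6 ≤ 0.319 * g ^ 6 := mul_le_mul_of_nonneg_right hq1 g60.le
  have F3 : q * g ^ 4 ≤ 0.319 * g ^ 4 := mul_le_mul_of_nonneg_right hq1 g4.le
  have F4 : (6 * q + 1) * q ^ 2 ≤ 2.914 * 0.102 :=
    mul_le_mul (by linarith) hq2 (by positivity) (by norm_num)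
  have F5 := mul_le_mul_of_nonneg_right F4 g60.le
  linarith

/-- anticoncentration of Rademacher sums under regularity of the weights. -/
theorem rademacher_anticoncentration_regular (n : ℕ) (hn : 2 ≤ n) (w : Fin n → ℝ)
    (i : Fin n) (δ : ℝ) (hδ0 : 0 < δ) (hδ1 : δ < 1) (μ : ℝ) (hμ : 0 < μ)
    (α : ℝ) (hα : α ≥ (1 + 2 * δ / (1 - δ)) * μ)
    (hsq_lo : (1 - δ) * ((n : ℝ) - 1) ≤ ∑ j ∈ Finset.univ.erase i, w j ^ 2)
    (hsq_hi : ∑ j ∈ Finset.univ.erase i, w j ^ 2 ≤ (1 + δ) * ((n : ℝ) - 1))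
    (hcube : ∑ j ∈ Finset.univ.erase i, |w j| ^ 3 ≤ (1 + δ) * μ * ((n : ℝ) - 1)) :
    unifPr n (fun x => |∑ j ∈ Finset.univ.erase i, w j * pm (x j)| ≤ α) ≥
      2 * (α - (1 + 2 * δ / (1 - δ)) * μ) / Real.sqrt (2 * Real.pi * (1 + δ) * ((n : ℝ) - 1))
      - α ^ 3 / (3 * Real.sqrt (2 * Real.pi) * ((1 - δ) * ((n : ℝ) - 1)) ^ ((3 : ℝ) / 2))
      - 6.8212 * ((1 + δ) * μ) ^ ((4 : ℝ) / 3) / ((1 - δ) ^ 2 * ((n : ℝ) - 1) ^ ((2 : ℝ) / 3)) := by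
  have hp := pi_pos
  have hm : 0 < (n : ℝ) - 1 := by
    have : (2 : ℝ) ≤ n := by exact_mod_cast hn
    linarith
  set m : ℝ := (n : ℝ) - 1
  have hd : 0 < 1 - δ := by linarith
  have hd2 : 0 < 1 + δ := by linarith
  have hrho : (1 + 2 * δ / (1 - δ)) * μ = (1 + δ) * μ / (1 - δ) := by field_simp; ring
  rw [hrho] at hα ⊢
  set ρ := (1 + δ) * μ / (1 - δ) with hρ
  have hρ0 : 0 < ρ := by positivity
  have hα0 : 0 < α := lt_of_lt_of_le hρ0 hα
  set S := ∑ j ∈ Finset.univ.erase i, w j ^ 2 with hS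
  have hS0 : 0 < S := lt_of_lt_of_le (by positivity) hsq_lo
  set σ := √S with hσ
  have hσ0 : 0 < σ := by positivity
  have hσ2 : σ ^ 2 = S := Real.sq_sqrt hS0.le
  set v : Fin n → ℝ := fun j => if j = i then 0 else w j / σ with hv
  have vi : v i = 0 := by simp [hv]
  have vj : ∀ j ∈ Finset.univ.erase i, v j = w j / σ := by
    intro j hj
    have := Finset.ne_of_mem_erase hj
    simp [hv, this]
  have h2 : ∑ j, v j ^ 2 = 1 := by
    rw [← Finset.add_sum_erase univ _ (Finset.mem_univ i), vi,
      Finset.sum_congr rfl (fun j hj => by rw [vj j hj, div_pow]), ← Finset.sum_div, ← hS, hσ2]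
    field_simp; norm_num
  have h3 : ∑ j, |v j| ^ 3 ≤ ρ / σ := by
    rw [← Finset.add_sum_erase univ _ (Finset.mem_univ i), vi,
      Finset.sum_congr rfl (fun j hj => by rw [vj j hj, abs_div, abs_of_pos hσ0, div_pow]),
      ← Finset.sum_div]
    simp only [abs_zero, ne_eq, OfNat.ofNat_ne_zero, not_false_eq_true, zero_pow, zero_add]
    rw [div_le_div_iff₀ (by positivity) hσ0]
    have e : ρ * σ ^ 3 = ρ * S * σ := by rw [← hσ2]; ring
    rw [e]
    apply mul_le_mul_of_nonneg_right _ hσ0.le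
    have h := mul_le_mul_of_nonneg_left hsq_lo hρ0.le
    have e2 : ρ * ((1 - δ) * m) = (1 + δ) * μ * m := by rw [hρ]; field_simp
    linarith
  set g := (ρ / σ) ^ ((1 : ℝ) / 3) with hg
  have hg0 : 0 < g := by positivity
  have hg3 : g ^ 3 = ρ / σ := by
    rw [hg, ← Real.rpow_natCast, ← Real.rpow_mul (by positivity)]; norm_num
  have hg4 : g ^ 4 = (ρ / σ) ^ ((4 : ℝ) / 3) := by
    rw [hg, ← Real.rpow_natCast, ← Real.rpow_mul (by positivity)]; norm_num
  have C := core n v g hg0 h2 (by rw [hg3]; exact h3) (α / σ) (by positivity)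
  have ev : (fun x : Fin n → Bool => |∑ j, v j * pm (x j)| ≤ α / σ) =
      (fun x => |∑ j ∈ Finset.univ.erase i, w j * pm (x j)| ≤ α) := by
    funext x
    have e : ∑ j, v j * pm (x j) = (∑ j ∈ Finset.univ.erase i, w j * pm (x j)) / σ := by
      rw [← Finset.add_sum_erase univ _ (Finset.mem_univ i), vi, zero_mul, zero_add, Finset.sum_div]
      apply Finset.sum_congr rfl
      intro j hj
      rw [vj j hj]; ring
    rw [e, abs_div, abs_of_pos hσ0, div_le_div_iff_of_pos_right hσ0]
  rw [ev] at C
  refine le_trans ?_ C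
  have hr0 : 0 < √(2 * π) := by positivity
  have T1 : 2 * (α - ρ) / √(2 * π * (1 + δ) * m) ≤ 2 * (α - ρ) / (√(2 * π) * σ) := by
    apply div_le_div_of_nonneg_left (by linarith) (by positivity)
    rw [hσ, ← Real.sqrt_mul (by positivity), mul_assoc (2 * π)]
    apply Real.sqrt_le_sqrt
    exact mul_le_mul_of_nonneg_left hsq_hi (by positivity)
  have T2 : α ^ 3 / (3 * √(2 * π) * σ ^ 3) ≤ α ^ 3 / (3 * √(2 * π) * ((1 - δ) * m) ^ ((3 : ℝ) / 2)) := by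
    apply div_le_div_of_nonneg_left (by positivity) (by positivity)
    apply mul_le_mul_of_nonneg_left _ (by positivity)
    have : σ ^ 3 = S ^ ((3 : ℝ) / 2) := by
      rw [hσ, Real.sqrt_eq_rpow, ← Real.rpow_natCast, ← Real.rpow_mul hS0.le]; norm_num
    rw [this]
    exact Real.rpow_le_rpow (by positivity) hsq_lo (by norm_num)
  have T3 : g ^ 4 ≤ ((1 + δ) * μ) ^ ((4 : ℝ) / 3) / ((1 - δ) ^ 2 * m ^ ((2 : ℝ) / 3)) := by
    have e1 : σ ^ ((4 : ℝ) / 3) = S ^ ((2 : ℝ) / 3) := by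
      rw [hσ, Real.sqrt_eq_rpow, ← Real.rpow_mul hS0.le]; norm_num
    have e2 : (1 - δ) ^ 2 = (1 - δ) ^ ((4 : ℝ) / 3) * (1 - δ) ^ ((2 : ℝ) / 3) := by
      rw [← Real.rpow_add hd, ← Real.rpow_natCast]; norm_num
    rw [hg4, Real.div_rpow hρ0.le hσ0.le, hρ, Real.div_rpow (by positivity) hd.le, e1, div_div, e2,
      mul_assoc, ← Real.mul_rpow hd.le hm.le]
    apply div_le_div_of_nonneg_left (by positivity) (by positivity)
    apply mul_le_mul_of_nonneg_left _ (by positivity)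
    exact Real.rpow_le_rpow (by positivity) hsq_lo (by norm_num)
  have T4 : (2 * (α / σ) - 2 * g ^ 3 - (α / σ) ^ 3 / 3) / √(2 * π) =
      2 * (α - ρ) / (√(2 * π) * σ) - α ^ 3 / (3 * √(2 * π) * σ ^ 3) := by
    rw [hg3]; field_simp
  rw [T4]
  have T5 : 6.8212 * ((1 + δ) * μ) ^ ((4 : ℝ) / 3) / ((1 - δ) ^ 2 * m ^ ((2 : ℝ) / 3)) =
    6.8212 * (((1 + δ) * μ) ^ ((4 : ℝ) / 3) / ((1 - δ) ^ 2 * m ^ ((2 : ℝ) / 3))) := by ring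
  rw [T5]
  linarith
end

section
/- There exist constants c₁, c₂ > 0 and N ∈ ℕ such that for all n ≥ N the following holds: if w₀, w₁, …, w_n are independent random variables, each uniformly distributed on the interval [−1,1], and f : {−1,1}^n → {−1,1} is the random linear threshold function f(x) = sign(w₀ + Σ_{i=1}^n w_i x_i), then with probability at least 1 − e^{−c₂ n} over the choice of the weights, Inf(f) ≥ c₁·√n. -/
open Finset Real MeasureTheory ProbabilityTheory
open scoped Classical

/-- The uniform probability measure on the interval [−1,1]. -/
noncomputable def unifIcc : Measure ℝ :=
  (volume (Set.Icc (-1 : ℝ) 1))⁻¹ • volume.restrict (Set.Icc (-1 : ℝ) 1)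

lemma unifExp_mono {n : ℕ} {g h : (Fin n → Bool) → ℝ} (H : ∀ x, g x ≤ h x) :
    unifExp n g ≤ unifExp n h := by
  unfold unifExp
  gcongr with x
  exact H x

lemma unifExp_succ (n : ℕ) (g : (Fin (n + 1) → Bool) → ℝ) :
    unifExp (n + 1) g =
      unifExp n (fun x => (g (Fin.cons true x) + g (Fin.cons false x)) / 2) := by
  unfold unifExp
  rw [← (Fin.consEquiv (fun _ : Fin (n + 1) => Bool)).sum_comp, Fintype.sum_prod_type,
    Fintype.sum_bool, ← Finset.sum_div, Finset.sum_add_distrib]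
  simp only [Fin.consEquiv, Equiv.coe_fn_mk]
  rw [pow_succ]
  field_simp

lemma unifExp_add {n : ℕ} (g h : (Fin n → Bool) → ℝ) :
    unifExp n (fun x => g x + h x) = unifExp n g + unifExp n h := by
  unfold unifExp
  rw [Finset.sum_add_distrib, add_div]

lemma unifExp_mul {n : ℕ} (c : ℝ) (g : (Fin n → Bool) → ℝ) :
    unifExp n (fun x => c * g x) = c * unifExp n g := by
  unfold unifExp
  rw [← Finset.mul_sum, mul_div_assoc]

lemma unifExp_const {n : ℕ} (c : ℝ) : unifExp n (fun _ => c) = c := by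
  unfold unifExp
  simp

/-- The linear form. -/
noncomputable def lin (n : ℕ) (a : Fin n → ℝ) (x : Fin n → Bool) : ℝ := ∑ i, a i * pm (x i)

lemma lin_cons (n : ℕ) (a : Fin (n + 1) → ℝ) (b : Bool) (x : Fin n → Bool) :
    lin (n + 1) a (Fin.cons b x) = a 0 * pm b + lin n (fun i => a i.succ) x := by
  simp [lin, Fin.sum_univ_succ]

lemma second_moment (n : ℕ) (a : Fin n → ℝ) :
    unifExp n (fun x => lin n a x ^ 2) = ∑ i, a i ^ 2 := by
  induction n with
  | zero => simp [unifExp, lin]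
  | succ n ih =>
    rw [unifExp_succ, Fin.sum_univ_succ, ← ih (fun i => a i.succ),
      ← unifExp_const (n := n) (a 0 ^ 2), ← unifExp_add]
    congr 1
    funext x
    simp only [lin_cons, pm]
    norm_num
    ring

lemma fourth_moment (n : ℕ) (a : Fin n → ℝ) :
    unifExp n (fun x => lin n a x ^ 4) ≤ 3 * (∑ i, a i ^ 2) ^ 2 := by
  induction n with
  | zero => simp [unifExp, lin]
  | succ n ih =>
    have h : unifExp (n + 1) (fun x => lin (n + 1) a x ^ 4) =
        a 0 ^ 4 + (6 * a 0 ^ 2 * unifExp n (fun x => lin n (fun i => a i.succ) x ^ 2) +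
          unifExp n (fun x => lin n (fun i => a i.succ) x ^ 4)) := by
      rw [unifExp_succ, ← unifExp_const (n := n) (a 0 ^ 4), ← unifExp_mul, ← unifExp_add,
        ← unifExp_add]
      congr 1
      funext x
      simp only [lin_cons, pm]
      norm_num
      ring
    rw [h, second_moment, Fin.sum_univ_succ]
    have := ih (fun i => a i.succ)
    nlinarith [sq_nonneg (a 0 ^ 2)]

lemma khintchine (n : ℕ) (a : Fin n → ℝ) (s : ℝ) (hs : 0 < s) (h : ∑ i, a i ^ 2 = s ^ 2) :
    s / 4 ≤ unifExp n (fun x => |lin n a x|) := by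
  have key : ∀ x, (1 / s) * lin n a x ^ 2 + (-(1 / (4 * s ^ 3))) * lin n a x ^ 4
      ≤ |lin n a x| := by
    intro x
    obtain ⟨u, hu⟩ : ∃ u, |lin n a x| = s * u := ⟨|lin n a x| / s, by field_simp⟩
    have hu0 : 0 ≤ u := by
      have := abs_nonneg (lin n a x)
      rw [hu] at this
      exact nonneg_of_mul_nonneg_right this hs
    have h2 : lin n a x ^ 2 = (s * u) ^ 2 := by rw [← hu, sq_abs]
    have h4 : lin n a x ^ 4 = (s * u) ^ 4 := by
      rw [show lin n a x ^ 4 = (lin n a x ^ 2) ^ 2 by ring, h2]; ring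
    rw [hu, h2, h4]
    have e : (1 / s) * (s * u) ^ 2 + (-(1 / (4 * s ^ 3))) * (s * u) ^ 4
      = s * (u * (u - u ^ 3 / 4)) := by field_simp; ring
    rw [e]
    have : u - u ^ 3 / 4 ≤ 1 := by
      nlinarith [mul_nonneg hu0 (sq_nonneg (u - 1)), sq_nonneg (u - 1), sq_nonneg (u-3/2),
        mul_nonneg hu0 (sq_nonneg (u - 6/5)), sq_nonneg (u - 6/5)]
    calc s * (u * (u - u ^ 3 / 4)) ≤ s * (u * 1) := by gcongr
      _ = s * u := by ring
  have := unifExp_mono key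
  rw [unifExp_add, unifExp_mul, unifExp_mul, second_moment, h] at this
  refine le_trans ?_ this
  have h4 := fourth_moment n a
  rw [h] at h4
  have : 1 / (4 * s ^ 3) * unifExp n (fun x => lin n a x ^ 4)
    ≤ 1 / (4 * s ^ 3) * (3 * (s ^ 2) ^ 2) := by gcongr
  have e : 1 / (4 * s ^ 3) * (3 * (s ^ 2) ^ 2) = 3 / 4 * s := by field_simp
  have e2 : 1 / s * s ^ 2 = s := by field_simp
  rw [e2]
  linarith

lemma flipAt_flipAt {n : ℕ} (i : Fin n) (x : Fin n → Bool) : flipAt i (flipAt i x) = x := by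
  simp [flipAt]

lemma coeff_le_infl {n : ℕ} (f : (Fin n → Bool) → ℝ) (hf : ∀ x, f x = 1 ∨ f x = -1) (i : Fin n) :
    |unifExp n (fun x => f x * pm (x i))| ≤ infl f i := by
  have h1 : ∑ x : Fin n → Bool, f x * pm (x i) = - ∑ x, f (flipAt i x) * pm (x i) := by
    rw [← Equiv.sum_comp (Function.Involutive.toPerm (flipAt i) (flipAt_flipAt i)),
      ← Finset.sum_neg_distrib]
    refine Finset.sum_congr rfl fun x _ => ?_
    change f (flipAt i x) * pm (flipAt i x i) = _
    have : pm (flipAt i x i) = - pm (x i) := by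
      cases h : x i <;> simp [flipAt, pm, h]
    rw [this]; ring
  have h2 : ∑ x : Fin n → Bool, f x * pm (x i)
      = ∑ x, (f x - f (flipAt i x)) / 2 * pm (x i) := by
    have : ∑ x, (f x - f (flipAt i x)) / 2 * pm (x i)
      = (∑ x : Fin n → Bool, f x * pm (x i) - ∑ x, f (flipAt i x) * pm (x i)) / 2 := by
      rw [← Finset.sum_sub_distrib, Finset.sum_div]
      refine Finset.sum_congr rfl fun x _ => by ring
    rw [this]; linarith
  unfold unifExp infl unifPr
  rw [abs_div, abs_of_pos (by positivity : (0:ℝ) < 2 ^ n), h2]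
  gcongr
  rw [Finset.card_filter]
  push_cast
  refine (Finset.abs_sum_le_sum_abs _ _).trans (Finset.sum_le_sum fun x _ => ?_)
  have hp : |pm (x i)| = 1 := by cases h : x i <;> simp [pm]
  rw [abs_mul, hp, mul_one]
  rcases hf x with h | h <;> rcases hf (flipAt i x) with h' | h' <;> rw [h, h'] <;> norm_num

lemma ltf_pm (n : ℕ) (w : Fin (n + 1) → ℝ) (x) : ltf n w x = 1 ∨ ltf n w x = -1 := by
  unfold ltf sgn
  split_ifs <;> simp

lemma infl_lower (n : ℕ) (w : Fin (n + 1) → ℝ) (hw : ∀ i, |w i| ≤ 1) :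
    unifExp n (fun x => |lin n (fun i => w i.succ) x|) - 2 ≤ totalInfl (ltf n w) := by
  have h1 : ∀ x, |lin n (fun i => w i.succ) x| + (-2) ≤ ltf n w x * lin n (fun i => w i.succ) x := by
    intro x
    have h0 := abs_le.1 (hw 0)
    change _ ≤ sgn (w 0 + lin n (fun i => w i.succ) x) * _
    generalize lin n (fun i => w i.succ) x = S
    unfold sgn
    rcases abs_cases S with ⟨h, _⟩ | ⟨h, _⟩ <;> split_ifs <;> linarith
  have h2 := unifExp_mono h1
  rw [unifExp_add, unifExp_const] at h2
  have h3 : unifExp n (fun x => ltf n w x * lin n (fun i => w i.succ) x)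
      = ∑ i : Fin n, w i.succ * unifExp n (fun x => ltf n w x * pm (x i)) := by
    simp only [unifExp, lin, Finset.mul_sum, mul_div_assoc', ← Finset.sum_div]
    rw [Finset.sum_comm]
    congr 1
    refine Finset.sum_congr rfl fun i _ => Finset.sum_congr rfl fun x _ => by ring
  rw [h3] at h2
  refine le_trans (by linarith) (h2.trans (Finset.sum_le_sum fun i _ => ?_))
  calc _ ≤ |w i.succ * unifExp n (fun x => ltf n w x * pm (x i))| := le_abs_self _
    _ ≤ 1 * infl (ltf n w) i := by
        rw [abs_mul]
        gcongr
        · exact hw _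
        · exact coeff_le_infl _ (ltf_pm n w) i
    _ = _ := one_mul _

instance : IsProbabilityMeasure unifIcc := by
  constructor
  simp only [unifIcc, Measure.smul_apply, Measure.restrict_apply_univ, smul_eq_mul]
  rw [Real.volume_Icc]
  apply ENNReal.inv_mul_cancel <;> norm_num

lemma unifIcc_ae : ∀ᵐ t ∂unifIcc, |t| ≤ 1 := by
  unfold unifIcc
  apply Measure.ae_smul_measure
  filter_upwards [ae_restrict_mem measurableSet_Icc] with t ht
  exact abs_le.2 ht

lemma exp_integrable : Integrable (fun t : ℝ => Real.exp (-t ^ 2)) unifIcc := by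
  refine Integrable.of_bound (C := 1) (by fun_prop) (ae_of_all _ fun t => ?_)
  rw [Real.norm_eq_abs, abs_of_pos (Real.exp_pos _)]
  exact Real.exp_le_one_iff.2 (by nlinarith [sq_nonneg t])

lemma exp_le_aux (u : ℝ) (h0 : 0 ≤ u) (h1 : u ≤ 1) : Real.exp (-u) ≤ 1 - u / 2 := by
  rw [Real.exp_neg, inv_le_comm₀ (Real.exp_pos _) (by linarith)]
  refine le_trans ?_ (Real.add_one_le_exp u)
  rw [inv_le_iff_one_le_mul₀ (by linarith)]
  nlinarith

lemma exp_integral : ∫ t, Real.exp (-t ^ 2) ∂unifIcc ≤ Real.exp (-(1 / 6)) := by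
  have h : ∫ t, (1 - t ^ 2 / 2) ∂unifIcc = 5 / 6 := by
    unfold unifIcc
    rw [integral_smul_measure, integral_Icc_eq_integral_Ioc,
      ← intervalIntegral.integral_of_le (by norm_num), Real.volume_Icc]
    rw [intervalIntegral.integral_sub (by simp) (by
      apply Continuous.intervalIntegrable; fun_prop)]
    simp
    norm_num
  have h56 : (5 / 6 : ℝ) ≤ Real.exp (-(1 / 6)) := by
    have := Real.add_one_le_exp (-(1 / 6) : ℝ)
    linarith
  refine le_trans ?_ h56
  rw [← h]
  have hI : Integrable (fun t : ℝ => 1 - t ^ 2 / 2) unifIcc := by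
    refine Integrable.of_bound (C := 1) (by fun_prop) ?_
    filter_upwards [unifIcc_ae] with t ht
    have := (sq_le_one_iff_abs_le_one t).2 ht
    rw [Real.norm_eq_abs, abs_le]
    constructor <;> nlinarith [sq_nonneg t]
  refine integral_mono_ae exp_integrable hI ?_
  filter_upwards [unifIcc_ae] with t ht
  exact exp_le_aux _ (sq_nonneg t) ((sq_le_one_iff_abs_le_one t).2 ht)

lemma chernoff (m : ℕ) :
    (Measure.pi fun _ : Fin m => unifIcc).real {w | ∑ i, w i ^ 2 ≤ (m : ℝ) / 12}
      ≤ Real.exp (-(m : ℝ) / 12) := by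
  have hint : Integrable (fun w : Fin m → ℝ => ∏ i, Real.exp (-(w i) ^ 2))
      (Measure.pi fun _ : Fin m => unifIcc) :=
    Integrable.fintype_prod (f := fun _ t => Real.exp (-t ^ 2)) (fun _ => exp_integrable)
  have h := mul_meas_ge_le_integral_of_nonneg (μ := Measure.pi fun _ : Fin m => unifIcc)
    (f := fun w : Fin m → ℝ => ∏ i, Real.exp (-(w i) ^ 2))
    (ae_of_all _ fun w => Finset.prod_nonneg fun i _ => (Real.exp_pos _).le) hint
    (Real.exp (-(m : ℝ) / 12))
  rw [integral_fintype_prod_eq_pow (fun t => Real.exp (-t ^ 2)), Fintype.card_fin] at h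
  have h2 : (∫ t, Real.exp (-t ^ 2) ∂unifIcc) ^ m ≤ Real.exp (-(1 / 6)) ^ m :=
    pow_le_pow_left₀ (integral_nonneg fun t => (Real.exp_pos _).le) exp_integral m
  rw [← Real.exp_nat_mul, show (m : ℝ) * (-(1 / 6)) = -(m : ℝ) / 12 + -(m : ℝ) / 12 by ring,
    Real.exp_add] at h2
  have h3 := le_of_mul_le_mul_left (h.trans h2) (Real.exp_pos _)
  refine le_trans (le_of_eq ?_) h3
  congr 1
  ext w
  simp only [Set.mem_ofPred_eq]
  rw [← Real.exp_sum, Real.exp_le_exp, Finset.sum_neg_distrib, neg_div, neg_le_neg_iff]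

lemma good_weights (n : ℕ) (hn : 4096 ≤ n) (w : Fin (n + 1) → ℝ) (hw : ∀ i, |w i| ≤ 1)
    (h : ((n + 1 : ℕ) : ℝ) / 12 < ∑ i, w i ^ 2) :
    1 / 32 * Real.sqrt n ≤ totalInfl (ltf n w) := by
  rw [Fin.sum_univ_succ] at h
  have hn' : (4096 : ℝ) ≤ n := by exact_mod_cast hn
  have h0 := (sq_le_one_iff_abs_le_one (w 0)).2 (hw 0)
  push_cast at h
  set Q := ∑ i : Fin n, w i.succ ^ 2 with hQ
  have hQn : (n : ℝ) / 16 ≤ Q := by linarith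
  have hQ0 : 0 < Q := by linarith
  have k := khintchine n (fun i => w i.succ) (Real.sqrt Q) (Real.sqrt_pos.2 hQ0)
    (by rw [Real.sq_sqrt hQ0.le])
  have l := infl_lower n w hw
  have a1 : Real.sqrt n / 4 ≤ Real.sqrt Q := by
    apply Real.le_sqrt_of_sq_le
    rw [div_pow, Real.sq_sqrt (by linarith)]
    linarith
  have a2 : 64 ≤ Real.sqrt n := by
    apply Real.le_sqrt_of_sq_le
    linarith
  linarith

/-- a random LTF with i.i.d. uniform [−1,1] weights has influence
Ω(√n) with probability 1 − e^{−Ω(n)}. -/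
theorem random_uniform_ltf_influence :
    ∃ c₁ c₂ : ℝ, 0 < c₁ ∧ 0 < c₂ ∧ ∃ N : ℕ, ∀ n : ℕ, N ≤ n →
      (Measure.pi fun _ : Fin (n + 1) => unifIcc)
          {w : Fin (n + 1) → ℝ | c₁ * Real.sqrt n ≤ totalInfl (ltf n w)} ≥
        ENNReal.ofReal (1 - Real.exp (-c₂ * n)) := by
  refine ⟨1 / 32, 1 / 12, by norm_num, by norm_num, 4096, fun n hn => ?_⟩
  set μ := Measure.pi fun _ : Fin (n + 1) => unifIcc with hμ
  set A := {w : Fin (n + 1) → ℝ | 1 / 32 * Real.sqrt n ≤ totalInfl (ltf n w)} with hA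
  set B := {w : Fin (n + 1) → ℝ | ∑ i, w i ^ 2 ≤ ((n + 1 : ℕ) : ℝ) / 12} with hB
  have hcube : ∀ᵐ w ∂μ, ∀ i, |w i| ≤ 1 :=
    Filter.eventually_all.2 fun i => (Measure.tendsto_eval_ae_ae (μ := fun _ : Fin (n + 1) => unifIcc)
      (i := i)).eventually unifIcc_ae
  have hle : μ Set.univ ≤ μ (A ∪ B) := by
    refine measure_mono_ae ?_
    filter_upwards [hcube] with w hw _
    by_cases hb : w ∈ B
    · exact Or.inr hb
    · exact Or.inl (good_weights n hn w hw (not_le.1 hb))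
  rw [measure_univ] at hle
  have hBle : μ B ≤ ENNReal.ofReal (Real.exp (-(1 / 12) * n)) := by
    rw [← ofReal_measureReal]
    refine ENNReal.ofReal_le_ofReal ((chernoff (n + 1)).trans (Real.exp_le_exp.2 ?_))
    push_cast
    linarith
  rw [ge_iff_le, ENNReal.ofReal_sub _ (Real.exp_pos _).le, ENNReal.ofReal_one]
  refine tsub_le_iff_right.2 (hle.trans ((measure_union_le _ _).trans ?_))
  gcongr
end
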